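/- arXiv:0707.0691 — 9 statements merged into one kernel-verified Lean document; each statement's English description precedes it below -/
import Mathlib

section
/- Let ρ_A be a density matrix on ℂ^{d_A} and ρ_E a density matrix on ℂ^{d_E}. Then the infimum of the set {λ ∈ ℝ | there exists a density matrix σ on ℂ^{d_E} with ρ_A ⊗ ρ_E ≤ λ (I_{d_A} ⊗ σ)} equals the infimum of the set {λ ∈ ℝ | ρ_A ≤ λ I_{d_A}}. (Equivalently: for a product state the conditional min-entropy H∞(A|E) equals the unconditional min-entropy H∞(A).) -/
open Matrix Kronecker ComplexOrder

noncomputable section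

/-- A density matrix: positive semidefinite with trace 1. -/
def IsDensity {d : Type*} [Fintype d] (ρ : Matrix d d ℂ) : Prop :=
  ρ.PosSemidef ∧ ρ.trace = 1

/-- Loewner order: `A ≤ B` iff `B - A` is positive semidefinite. -/
def LoewnerLE {d : Type*} [Fintype d] (A B : Matrix d d ℂ) : Prop :=
  (B - A).PosSemidef

/-- For a product state `ρ_A ⊗ ρ_E`, the conditional min-entropy
of `A` given `E` equals the unconditional min-entropy of `A`:
`inf {λ | ∃ density σ, ρ_A ⊗ ρ_E ≤ λ (I ⊗ σ)} = inf {λ | ρ_A ≤ λ I}`. -/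
theorem product_state_conditional_min_entropy {dA dE : ℕ}
    (ρA : Matrix (Fin dA) (Fin dA) ℂ) (ρE : Matrix (Fin dE) (Fin dE) ℂ)
    (hρA : IsDensity ρA) (hρE : IsDensity ρE) :
    sInf {c : ℝ | ∃ σ : Matrix (Fin dE) (Fin dE) ℂ, IsDensity σ ∧
        LoewnerLE (ρA ⊗ₖ ρE) ((c : ℂ) • ((1 : Matrix (Fin dA) (Fin dA) ℂ) ⊗ₖ σ))}
      = sInf {c : ℝ | LoewnerLE ρA ((c : ℂ) • (1 : Matrix (Fin dA) (Fin dA) ℂ))} := by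
  congr 1
  ext c
  simp only [Set.mem_ofPred_eq, LoewnerLE]
  constructor
  · rintro ⟨σ, hσ, h⟩
    have h2 := Matrix.posSemidef_sum (Finset.univ : Finset (Fin dE))
      (fun e _ => h.submatrix (fun a : Fin dA => (a, e)))
    convert h2 using 1
    ext i j
    have h3 : ∑ e, σ e e = 1 := hσ.2
    have h4 : ∑ e, ρE e e = 1 := hρE.2
    simp only [Matrix.sum_apply, Matrix.submatrix_apply, Matrix.sub_apply, Matrix.smul_apply,
      Matrix.kroneckerMap_apply, smul_eq_mul, Finset.sum_sub_distrib, ← Finset.mul_sum, h4,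
      mul_one]
    have h5 : ∑ e, (1 : Matrix (Fin dA) (Fin dA) ℂ) i j * σ e e
        = (1 : Matrix (Fin dA) (Fin dA) ℂ) i j := by
      rw [← Finset.mul_sum, h3, mul_one]
    exact congrArg (fun x => (c : ℂ) * x - ρA i j) h5.symm
  · intro h
    refine ⟨ρE, hρE, ?_⟩
    have key : (c : ℂ) • ((1 : Matrix (Fin dA) (Fin dA) ℂ) ⊗ₖ ρE) - ρA ⊗ₖ ρE
        = ((c : ℂ) • (1 : Matrix (Fin dA) (Fin dA) ℂ) - ρA) ⊗ₖ ρE := by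
      ext i j
      simp only [Matrix.sub_apply, Matrix.smul_apply, Matrix.kroneckerMap_apply, smul_eq_mul]
      ring
    rw [key]
    exact Matrix.PosSemidef.kronecker (𝕜 := ℂ) h hρE.1
end
end

section
/- Let K be a finite nonempty set, (p_k)_{k∈K} nonnegative reals with ∑_k p_k = 1, and for each k let ω_k be a density matrix on ℂ^{d_A} ⊗ ℂ^{d_E}. Define the density matrix ω on the system A⊗E⊗K by ω_{((a,e,k),(a',e',k'))} = p_k · [k = k'] · (ω_k)_{((a,e),(a',e'))}, and let ω^{AE} = ∑_k p_k ω_k. Then inf{λ ∈ ℝ | there exists a density matrix σ indexed by A×K such that ω ≤ λ · N_σ, where (N_σ)_{((a,e,k),(a',e',k'))} = [e = e'] · σ_{((a,k),(a',k'))}} ≤ |K| · inf{λ ∈ ℝ | there exists a density matrix τ on ℂ^{d_A} such that ω^{AE} ≤ λ · M_τ, where (M_τ)_{((a,e),(a',e'))} = [e = e'] · τ_{(a,a')}}. (Equivalently: H∞(E|AK)_ω ≥ H∞(E|A)_ω − log|K| when the K register is classical.) -/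
open Matrix Kronecker ComplexOrder

noncomputable section

lemma aux_block {n K : Type*} [Fintype n] [Fintype K] [DecidableEq K] [DecidableEq n]
    (B : K → Matrix n n ℂ) (hB : ∀ k, (B k).PosSemidef) :
    (Matrix.of fun (x y : n × K) => if x.2 = y.2 then B x.2 x.1 y.1 else 0).PosSemidef := by
  have h : (Matrix.of fun (x y : n × K) => if x.2 = y.2 then B x.2 x.1 y.1 else 0)
      = ∑ k, (B k) ⊗ₖ (Matrix.diagonal (fun j : K => if j = k then (1:ℂ) else 0)) := by
    ext x y
    simp [Matrix.sum_apply, Matrix.kroneckerMap_apply, Matrix.diagonal_apply]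
  rw [h]
  refine Matrix.posSemidef_sum _ fun k _ => (hB k).kronecker (Matrix.PosSemidef.diagonal ?_)
  intro j
  by_cases h : j = k <;> simp [h]

open scoped MatrixOrder Matrix.Norms.L2Operator in
lemma aux_bound {n : Type*} [Fintype n] [DecidableEq n] (A : Matrix n n ℂ) (hA : A.PosSemidef) :
    ∃ c : ℝ, ((c : ℂ) • (1 : Matrix n n ℂ) - A).PosSemidef := by
  refine ⟨‖A‖, ?_⟩
  have h : A ≤ algebraMap ℝ (Matrix n n ℂ) ‖A‖ :=
    IsSelfAdjoint.le_algebraMap_norm_self (a := A) hA.isHermitian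
  have h2 : ((‖A‖ : ℝ) : ℂ) • (1 : Matrix n n ℂ) = algebraMap ℝ (Matrix n n ℂ) ‖A‖ := by
    ext i j
    by_cases hij : i = j <;> simp [Matrix.algebraMap_matrix_apply, Matrix.one_apply, hij]
  rw [h2]
  exact Matrix.le_iff.mp h

/-- conditioning on a classical register `K` reduces the conditional
min-entropy by at most `log |K|`:
`inf {λ | ∃ density σ on A×K, ω ≤ λ N_σ} ≤ |K| · inf {λ | ∃ density τ on A, ω^{AE} ≤ λ M_τ}`,
where `ω` is the cq-state `∑_k p_k ω_k ⊗ |k⟩⟨k|` (indexed by triples `(a,e,k)`),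
`(N_σ)((a,e,k),(a',e',k')) = [e = e'] σ((a,k),(a',k'))` and
`(M_τ)((a,e),(a',e')) = [e = e'] τ(a,a')`. -/
theorem classical_register_min_entropy_chain_rule {dA dE : ℕ} {K : Type*}
    [Fintype K] [Nonempty K] [DecidableEq K]
    (p : K → ℝ) (hp : ∀ k, 0 ≤ p k) (hpsum : ∑ k, p k = 1)
    (ω : K → Matrix (Fin dA × Fin dE) (Fin dA × Fin dE) ℂ)
    (hω : ∀ k, IsDensity (ω k)) :
    sInf {c : ℝ | ∃ σ : Matrix (Fin dA × K) (Fin dA × K) ℂ, IsDensity σ ∧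
        LoewnerLE
          (Matrix.of fun (x y : Fin dA × Fin dE × K) =>
            (p x.2.2 : ℂ) * (if x.2.2 = y.2.2 then 1 else 0) *
              ω x.2.2 (x.1, x.2.1) (y.1, y.2.1))
          ((c : ℂ) • Matrix.of fun (x y : Fin dA × Fin dE × K) =>
            (if x.2.1 = y.2.1 then 1 else 0) * σ (x.1, x.2.2) (y.1, y.2.2))}
      ≤ (Fintype.card K : ℝ) *
        sInf {c : ℝ | ∃ τ : Matrix (Fin dA) (Fin dA) ℂ, IsDensity τ ∧
          LoewnerLE (∑ k, (p k : ℂ) • ω k)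
            ((c : ℂ) • Matrix.of fun (x y : Fin dA × Fin dE) =>
              (if x.2 = y.2 then 1 else 0) * τ x.1 y.1)} := by
  classical
  obtain ⟨k₀⟩ := ‹Nonempty K›
  have hKpos : (0:ℝ) < Fintype.card K := by exact_mod_cast Fintype.card_pos_iff.mpr ⟨k₀⟩
  have hK0 : (Fintype.card K : ℂ) ≠ 0 := by exact_mod_cast hKpos.ne'
  have hpC : ∀ k, (0:ℂ) ≤ (p k : ℂ) := fun k => by exact_mod_cast hp k
  have hne : Nonempty (Fin dA × Fin dE) := by
    by_contra h
    rw [not_nonempty_iff] at h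
    have := (hω k₀).2
    simp [Matrix.trace] at this
  obtain ⟨a₀, e₀⟩ := hne
  have hdA : (dA : ℂ) ≠ 0 := by
    have : 0 < dA := a₀.pos
    exact_mod_cast this.ne'
  have hAE : (∑ k, (p k : ℂ) • ω k).PosSemidef :=
    Matrix.posSemidef_sum _ fun k _ => (hω k).1.smul (hpC k)
  rw [← div_le_iff₀' hKpos]
  refine le_csInf ?_ ?_
  · obtain ⟨c, hc⟩ := aux_bound _ hAE
    refine ⟨c * dA, ((dA : ℂ)⁻¹) • (1 : Matrix (Fin dA) (Fin dA) ℂ), ⟨?_, ?_⟩, ?_⟩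
    · refine Matrix.PosSemidef.one.smul ?_
      rw [← Complex.ofReal_natCast, ← Complex.ofReal_inv]
      exact_mod_cast (by positivity : (0:ℝ) ≤ (dA:ℝ)⁻¹)
    · simp [Matrix.trace_smul, hdA]
    · unfold LoewnerLE
      convert hc using 2
      ext x y
      rcases x with ⟨a, e⟩
      rcases y with ⟨a', e'⟩
      by_cases h1 : a = a' <;> by_cases h2 : e = e' <;>
        simp [Matrix.one_apply, h1, h2, hdA]
  · rintro c ⟨τ, ⟨hτ, hτt⟩, hle⟩
    rw [div_le_iff₀' hKpos]
    refine csInf_le ?_ ?_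
    · refine ⟨0, ?_⟩
      rintro b ⟨σ, ⟨hσ, hσt⟩, hb⟩
      have ht := Matrix.PosSemidef.trace_nonneg hb
      have h1 : (Matrix.of fun (x y : Fin dA × Fin dE × K) =>
            (p x.2.2 : ℂ) * (if x.2.2 = y.2.2 then 1 else 0) *
              ω x.2.2 (x.1, x.2.1) (y.1, y.2.1)).trace = 1 := by
        have h2 : ∀ k, ∑ a, ∑ e, ω k (a, e) (a, e) = 1 := fun k => by
          rw [← (hω k).2, Matrix.trace, Fintype.sum_prod_type]; rfl
        have : ∑ k, ∑ a, ∑ e, (p k : ℂ) * ω k (a, e) (a, e) = 1 := by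
          simp_rw [← Finset.mul_sum, h2, mul_one]
          exact_mod_cast hpsum
        refine Eq.trans ?_ this
        rw [Finset.sum_comm (s := (Finset.univ : Finset K))]
        simp only [Matrix.trace, Fintype.sum_prod_type]
        refine Finset.sum_congr rfl fun a _ => ?_
        rw [Finset.sum_comm]
        simp
      have h3 : (Matrix.of fun (x y : Fin dA × Fin dE × K) =>
            (if x.2.1 = y.2.1 then (1:ℂ) else 0) * σ (x.1, x.2.2) (y.1, y.2.2)).trace = dE := by
        have h4 : ∑ a, ∑ k, σ (a, k) (a, k) = 1 := by
          rw [← hσt, Matrix.trace, Fintype.sum_prod_type]; rfl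
        simp [Matrix.trace, Fintype.sum_prod_type]
        rw [← Finset.mul_sum, h4, mul_one]
      rw [Matrix.trace_sub, Matrix.trace_smul, h1, h3] at ht
      have h5 : (0:ℝ) ≤ b * dE - 1 := by
        have : ((b:ℂ) • (dE:ℂ) - 1) = ((b * dE - 1 : ℝ) : ℂ) := by simp
        rw [this] at ht
        exact_mod_cast ht
      by_contra hneg
      push Not at hneg
      have : (0:ℝ) ≤ dE := by positivity
      nlinarith
    · refine ⟨τ ⊗ₖ ((Fintype.card K : ℂ)⁻¹ • (1 : Matrix K K ℂ)), ⟨?_, ?_⟩, ?_⟩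
      · refine hτ.kronecker (Matrix.PosSemidef.one.smul ?_)
        rw [← Complex.ofReal_natCast, ← Complex.ofReal_inv]
        exact_mod_cast (by positivity : (0:ℝ) ≤ (Fintype.card K:ℝ)⁻¹)
      · rw [Matrix.trace_kronecker, hτt]
        simp [Matrix.trace_smul, hK0]
      · unfold LoewnerLE at hle ⊢
        have hB : ∀ k, (((c : ℂ) • Matrix.of fun (x y : Fin dA × Fin dE) =>
              (if x.2 = y.2 then 1 else 0) * τ x.1 y.1) - (p k : ℂ) • ω k).PosSemidef := by
          intro k
          have h6 : (∑ j ∈ Finset.univ.erase k, (p j : ℂ) • ω j).PosSemidef :=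
            Matrix.posSemidef_sum _ fun k _ => (hω k).1.smul (hpC k)
          have := hle.add h6
          rwa [← Finset.add_sum_erase _ _ (Finset.mem_univ k), sub_add_eq_sub_sub,
            sub_add_cancel] at this
        have := (aux_block _ hB).submatrix
          (fun x : Fin dA × Fin dE × K => ((x.1, x.2.1), x.2.2))
        convert this using 1
        ext x y
        rcases x with ⟨a, e, k⟩
        rcases y with ⟨a', e', k'⟩
        by_cases h1 : k = k'
        · subst h1
          simp [Matrix.kroneckerMap_apply]
          field_simp
        · simp [Matrix.kroneckerMap_apply, h1]
end
end

section
/- Let ρ be a density matrix on ℂ^{d_A} ⊗ ℂ^{d_E} and suppose there exists a density matrix σ on ℂ^{d_E} with ρ ≤ 2^{−t} (I_{d_A} ⊗ σ) for a real number t. Let r₀, r₁ ≥ 0 with r₀ + r₁ = 1 and let τ₀, τ₁ be density matrices on ℂ^{d_A} ⊗ ℂ^{d_E} with ρ = r₀ τ₀ + r₁ τ₁. Define τ̃₀ = r₀ τ₀ + r₁ ((tr_E ρ) ⊗ (tr_A τ₁)). Then there exists a density matrix σ' on ℂ^{d_E} with τ̃₀ ≤ 2^{−(t−1)} (I_{d_A}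 ⊗ σ'). (Equivalently: H∞(A|E) of τ̃₀ is at least t − 1.) -/
open Matrix Kronecker ComplexOrder

noncomputable section

/-- Partial trace over the first (A) system. -/
def ptraceA {A E : Type*} [Fintype A] (M : Matrix (A × E) (A × E) ℂ) : Matrix E E ℂ :=
  Matrix.of fun e e' => ∑ a, M (a, e) (a, e')

/-- Partial trace over the second (E) system. -/
def ptraceE {A E : Type*} [Fintype E] (M : Matrix (A × E) (A × E) ℂ) : Matrix A A ℂ :=
  Matrix.of fun a a' => ∑ e, M (a, e) (a', e)

theorem ptraceE_psd {A E : Type*} [Fintype A] [Fintype E] {M : Matrix (A × E) (A × E) ℂ}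
    (h : M.PosSemidef) : (ptraceE M).PosSemidef := by
  have : ptraceE M = ∑ e, M.submatrix (fun a => (a, e)) (fun a => (a, e)) := by
    ext a b
    simp [ptraceE, Matrix.sum_apply]
  rw [this]
  exact Matrix.posSemidef_sum _ fun e _ => h.submatrix _

theorem ptraceA_psd {A E : Type*} [Fintype A] [Fintype E] {M : Matrix (A × E) (A × E) ℂ}
    (h : M.PosSemidef) : (ptraceA M).PosSemidef := by
  have : ptraceA M = ∑ a, M.submatrix (fun e => (a, e)) (fun e => (a, e)) := by
    ext a b
    simp [ptraceA, Matrix.sum_apply]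
  rw [this]
  exact Matrix.posSemidef_sum _ fun e _ => h.submatrix _

theorem ptraceA_trace {A E : Type*} [Fintype A] [Fintype E] (M : Matrix (A × E) (A × E) ℂ) :
    (ptraceA M).trace = M.trace := by
  simp only [Matrix.trace, ptraceA, Matrix.diag_apply, Matrix.of_apply, Fintype.sum_prod_type]
  exact Finset.sum_comm

/-- if `ρ = r₀ τ₀ + r₁ τ₁` has conditional min-entropy at least `t`
(witnessed by `ρ ≤ 2^{-t} (I ⊗ σ)` for some density `σ`), then
`τ̃₀ = r₀ τ₀ + r₁ ((tr_E ρ) ⊗ (tr_A τ₁))` has conditional min-entropy at least `t - 1`. -/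
theorem tau_tilde_min_entropy {dA dE : ℕ} (t : ℝ)
    (ρ τ0 τ1 : Matrix (Fin dA × Fin dE) (Fin dA × Fin dE) ℂ)
    (hρ : IsDensity ρ) (hτ0 : IsDensity τ0) (hτ1 : IsDensity τ1)
    (r0 r1 : ℝ) (hr0 : 0 ≤ r0) (hr1 : 0 ≤ r1) (hr : r0 + r1 = 1)
    (hmix : ρ = (r0 : ℂ) • τ0 + (r1 : ℂ) • τ1)
    (hmin : ∃ σ : Matrix (Fin dE) (Fin dE) ℂ, IsDensity σ ∧
      LoewnerLE ρ ((((2 : ℝ) ^ (-t) : ℝ) : ℂ) •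
        ((1 : Matrix (Fin dA) (Fin dA) ℂ) ⊗ₖ σ))) :
    ∃ σ' : Matrix (Fin dE) (Fin dE) ℂ, IsDensity σ' ∧
      LoewnerLE ((r0 : ℂ) • τ0 + (r1 : ℂ) • (ptraceE ρ ⊗ₖ ptraceA τ1))
        ((((2 : ℝ) ^ (-(t - 1)) : ℝ) : ℂ) •
          ((1 : Matrix (Fin dA) (Fin dA) ℂ) ⊗ₖ σ')) := by
  obtain ⟨σ, ⟨hσ, hσt⟩, hle⟩ := hmin
  unfold LoewnerLE at *
  have hc : (0 : ℝ) ≤ (2 : ℝ) ^ (-t) := by positivity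
  have h2 : (2 : ℝ) ^ (-(t - 1)) = 2 * (2 : ℝ) ^ (-t) := by
    rw [show -(t - 1) = 1 + -t by ring, Real.rpow_add (by norm_num), Real.rpow_one]
  rw [h2]
  generalize (2 : ℝ) ^ (-t) = c at *
  have hω := ptraceA_psd hτ1.1
  have hωt := (ptraceA_trace τ1).trans hτ1.2
  have hA := ptraceE_psd hle
  have hAe : ptraceE ((c : ℂ) • ((1 : Matrix (Fin dA) (Fin dA) ℂ) ⊗ₖ σ) - ρ)
      = (c : ℂ) • (1 : Matrix (Fin dA) (Fin dA) ℂ) - ptraceE ρ := by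
    ext a b
    have : ∑ e, σ e e = 1 := hσt
    simp [ptraceE, Finset.sum_sub_distrib, ← Finset.mul_sum]
    left
    change ∑ i, (1 : Matrix (Fin dA) (Fin dA) ℂ) a b * σ i i = _
    rw [← Finset.mul_sum, this, mul_one]
  rw [hAe] at hA
  have hc' : (0 : ℂ) ≤ (c : ℂ) := by exact_mod_cast hc
  have hr0' : (0 : ℂ) ≤ (r0 : ℂ) := by exact_mod_cast hr0
  have hr1' : (0 : ℂ) ≤ (r1 : ℂ) := by exact_mod_cast hr1
  have hhalf : (0 : ℂ) ≤ ((1 / 2 : ℝ) : ℂ) := by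
    exact_mod_cast (by norm_num : (0 : ℝ) ≤ 1 / 2)
  refine ⟨((1 / 2 : ℝ) : ℂ) • (σ + ptraceA τ1), ⟨(hσ.add hω).smul hhalf, ?_⟩, ?_⟩
  · rw [Matrix.trace_smul, Matrix.trace_add, hσt, hωt]
    norm_num
  · have key := ((hle.add (hτ1.1.smul hr1')).add ((hA.kronecker hω).smul hr1')).add
      ((((Matrix.PosSemidef.one (n := Fin dA) (R := ℂ)).kronecker hω).smul hc').smul hr0')
    convert key using 1
    have hr' : (r0 : ℂ) = 1 - r1 := by
      rw [eq_sub_iff_add_eq]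
      exact_mod_cast hr
    rw [hmix]
    ext ⟨a, e⟩ ⟨b, f⟩
    simp only [Matrix.sub_apply, Matrix.add_apply, Matrix.smul_apply, Matrix.kroneckerMap_apply,
      smul_eq_mul]
    rw [hr']
    push_cast
    ring
end
end

section
/- Let n be a positive integer, t a real number with t ≤ n − 1, and let ρ be a density matrix on ℂ^{2^n} ⊗ ℂ^{d_E} such that there exists a density matrix σ on ℂ^{d_E} with ρ ≤ 2^{−(t−1)} (I_{2^n} ⊗ σ). Define ρ̂ = (1/3) ρ + (2/3) ((I_{2^n}/2^n) ⊗ tr_A ρ). Then there exists a density matrix σ' on ℂ^{d_E} with ρ̂ ≤ 2^{−t} (I_{2^n} ⊗ σ'). (Equivalently: H∞(A|E) of ρ̂ is at least t.) -/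
open Matrix Kronecker ComplexOrder

noncomputable section

/-- if `t ≤ n - 1` and `ρ` (on `n` qubits tensor `E`) satisfies
`ρ ≤ 2^{-(t-1)} (I ⊗ σ)` for some density `σ`, then
`ρ̂ = (1/3) ρ + (2/3) ((I/2^n) ⊗ tr_A ρ)` satisfies `ρ̂ ≤ 2^{-t} (I ⊗ σ')`
for some density `σ'`. -/
theorem rho_hat_min_entropy {n dE : ℕ} (hn : 1 ≤ n) (t : ℝ) (ht : t ≤ (n : ℝ) - 1)
    (ρ : Matrix (Fin (2 ^ n) × Fin dE) (Fin (2 ^ n) × Fin dE) ℂ)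
    (hρ : IsDensity ρ)
    (hmin : ∃ σ : Matrix (Fin dE) (Fin dE) ℂ, IsDensity σ ∧
      LoewnerLE ρ ((((2 : ℝ) ^ (-(t - 1)) : ℝ) : ℂ) •
        ((1 : Matrix (Fin (2 ^ n)) (Fin (2 ^ n)) ℂ) ⊗ₖ σ))) :
    ∃ σ' : Matrix (Fin dE) (Fin dE) ℂ, IsDensity σ' ∧
      LoewnerLE ((1 / 3 : ℂ) • ρ +
          (2 / 3 : ℂ) • (((2 : ℂ) ^ n)⁻¹ •
            ((1 : Matrix (Fin (2 ^ n)) (Fin (2 ^ n)) ℂ) ⊗ₖ ptraceA ρ)))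
        ((((2 : ℝ) ^ (-t) : ℝ) : ℂ) •
          ((1 : Matrix (Fin (2 ^ n)) (Fin (2 ^ n)) ℂ) ⊗ₖ σ')) := by
  obtain ⟨σ, hσ, hle⟩ := hmin
  have hτ : (ptraceA ρ).PosSemidef := by
    have h : ptraceA ρ = ∑ a, ρ.submatrix (fun e => (a, e)) (fun e => (a, e)) := by
      ext e e'
      simp [ptraceA, Matrix.sum_apply]
    rw [h]
    exact Matrix.posSemidef_sum _ fun a _ => hρ.1.submatrix _
  have hτt : (ptraceA ρ).trace = 1 := by
    rw [← hρ.2]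
    simp only [Matrix.trace, ptraceA, Matrix.diag, Matrix.of_apply, Fintype.sum_prod_type]
    exact Finset.sum_comm
  have h3 : (0 : ℂ) ≤ 1 / 3 := by
    have : ((0 : ℝ) : ℂ) ≤ ((1 / 3 : ℝ) : ℂ) := Complex.real_le_real.2 (by norm_num)
    simpa using this
  have h23 : (0 : ℂ) ≤ 2 / 3 := by
    have : ((0 : ℝ) : ℂ) ≤ ((2 / 3 : ℝ) : ℂ) := Complex.real_le_real.2 (by norm_num)
    simpa using this
  refine ⟨(2 / 3 : ℂ) • σ + (1 / 3 : ℂ) • ptraceA ρ, ⟨(hσ.1.smul h23).add (hτ.smul h3), ?_⟩, ?_⟩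
  · rw [Matrix.trace_add, Matrix.trace_smul, Matrix.trace_smul, hσ.2, hτt]
    norm_num
  · unfold LoewnerLE at hle ⊢
    have e1 : (2 : ℝ) ^ (-(t - 1)) = 2 * (2 : ℝ) ^ (-t) := by
      rw [show -(t - 1) = 1 + -t by ring, Real.rpow_add (by norm_num), Real.rpow_one]
    have e2 : 2 * ((2 : ℝ) ^ n)⁻¹ ≤ (2 : ℝ) ^ (-t) := by
      have : 2 * ((2 : ℝ) ^ n)⁻¹ = (2 : ℝ) ^ (1 + -(n : ℝ)) := by
        rw [Real.rpow_add (by norm_num), Real.rpow_one, Real.rpow_neg (by norm_num),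
          Real.rpow_natCast]
      rw [this]
      exact Real.rpow_le_rpow_of_exponent_le (by norm_num) (by linarith)
    rw [e1] at hle
    generalize (2 : ℝ) ^ (-t) = c at *
    have hc : (0 : ℂ) ≤ (c : ℂ) - 2 * ((2 : ℂ) ^ n)⁻¹ := by
      have : ((0 : ℝ) : ℂ) ≤ ((c - 2 * ((2 : ℝ) ^ n)⁻¹ : ℝ) : ℂ) :=
        Complex.real_le_real.2 (by linarith)
      simpa using this
    have hI : ((1 : Matrix (Fin (2 ^ n)) (Fin (2 ^ n)) ℂ) ⊗ₖ ptraceA ρ).PosSemidef :=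
      Matrix.PosSemidef.one.kronecker hτ
    have := (hle.smul h3).add ((hI.smul hc).smul h3)
    convert this using 1
    rw [Matrix.kronecker_add, Matrix.kronecker_smul, Matrix.kronecker_smul]
    push_cast
    module
end
end

section
/- Let S be a Hermitian d×d complex matrix and let σ be a positive definite d×d complex matrix. Then ‖S‖₁ ≤ √( tr(σ) · tr(S σ^{−1/2} S σ^{−1/2}) ), where σ^{−1/2} is the inverse of the positive semidefinite square root of σ and the trace on the right-hand side is a nonnegative real number. -/
open Matrix Kronecker ComplexOrder

noncomputable section

/-- The positive semidefinite square root of a positive semidefinite matrix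
(as in the older Mathlib, from which it has since been removed). -/
def Matrix.PosSemidef.sqrt {n 𝕜 : Type*} [Fintype n] [RCLike 𝕜] [DecidableEq n]
    {A : Matrix n n 𝕜} (hA : A.PosSemidef) : Matrix n n 𝕜 :=
  hA.1.eigenvectorUnitary.1 * diagonal ((↑) ∘ Real.sqrt ∘ hA.1.eigenvalues) *
  (star hA.1.eigenvectorUnitary : Matrix n n 𝕜)

/-- Trace norm of a complex matrix: `tr √(MᴴM)`. -/
def traceNorm {d : Type*} [Fintype d] [DecidableEq d] (M : Matrix d d ℂ) : ℝ :=
  ((Matrix.posSemidef_conjTranspose_mul_self M).sqrt).trace.re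

theorem aux_conj_mul {d : ℕ} (V : Matrix.unitaryGroup (Fin d) ℂ) (f g : Fin d → ℂ) :
    (V.1 * diagonal f * (star V.1)) * (V.1 * diagonal g * (star V.1)) =
      V.1 * diagonal (fun i => f i * g i) * star V.1 := by
  have h : star V.1 * V.1 = 1 := Unitary.coe_star_mul_self V
  calc _ = V.1 * diagonal f * (star V.1 * V.1) * diagonal g * star V.1 := by
        simp only [Matrix.mul_assoc]
    _ = V.1 * (diagonal f * diagonal g) * star V.1 := by
        rw [h]; simp only [Matrix.mul_assoc, Matrix.one_mul]
    _ = _ := by rw [diagonal_mul_diagonal]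

theorem aux_psd {d : ℕ} (V : Matrix.unitaryGroup (Fin d) ℂ) (f : Fin d → ℝ) (hf : ∀ i, 0 ≤ f i) :
    (V.1 * diagonal (fun i => (f i : ℂ)) * star V.1).PosSemidef := by
  have h : (diagonal (fun i => (f i : ℂ))).PosSemidef :=
    Matrix.PosSemidef.diagonal (fun i => by simpa using hf i)
  exact h.mul_mul_conjTranspose_same V.1

theorem aux_herm {d : ℕ} (V : Matrix.unitaryGroup (Fin d) ℂ) (f : Fin d → ℝ) :
    (V.1 * diagonal (fun i => (f i : ℂ)) * star V.1).IsHermitian := by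
  have h : (diagonal (fun i => (f i : ℂ))).IsHermitian := by
    rw [Matrix.isHermitian_diagonal_iff]; intro i; simp [isSelfAdjoint_iff]
  exact Matrix.isHermitian_mul_mul_conjTranspose V.1 h

theorem aux_trace {d : ℕ} (V : Matrix.unitaryGroup (Fin d) ℂ) (f : Fin d → ℂ) :
    (V.1 * diagonal f * star V.1).trace = ∑ i, f i := by
  have h : star V.1 * V.1 = 1 := Unitary.coe_star_mul_self V
  rw [Matrix.trace_mul_comm, ← Matrix.mul_assoc, h, Matrix.one_mul, Matrix.trace_diagonal]

theorem aux_sqrt_psd {d : ℕ} {A : Matrix (Fin d) (Fin d) ℂ} (hA : A.PosSemidef) :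
    hA.sqrt.PosSemidef :=
  aux_psd hA.1.eigenvectorUnitary (fun i => Real.sqrt (hA.1.eigenvalues i))
    (fun _ => Real.sqrt_nonneg _)

theorem aux_spec {d : ℕ} {A : Matrix (Fin d) (Fin d) ℂ} (hA : A.IsHermitian) :
    A = hA.eigenvectorUnitary.1 * diagonal (fun i => (hA.eigenvalues i : ℂ)) *
      star hA.eigenvectorUnitary.1 :=
  hA.spectral_theorem

theorem aux_sqrt_mul {d : ℕ} {A : Matrix (Fin d) (Fin d) ℂ} (hA : A.PosSemidef) :
    hA.sqrt * hA.sqrt = A := by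
  refine (aux_conj_mul hA.1.eigenvectorUnitary _ _).trans ?_
  conv_rhs => rw [aux_spec hA.1]
  congr 3
  funext i
  simp only [Function.comp]
  have := Real.mul_self_sqrt (hA.eigenvalues_nonneg i)
  exact (Complex.ofReal_mul _ _).symm.trans (congrArg Complex.ofReal this)

open scoped MatrixOrder in
theorem aux_unique {d : ℕ} {A B : Matrix (Fin d) (Fin d) ℂ} (hA : A.PosSemidef)
    (hB : B.PosSemidef) (h : A * A = B * B) : A = B :=
  (CFC.mul_self_eq_mul_self_iff A B hA.nonneg hB.nonneg).1 h

theorem aux_sign {d : ℕ} (S : Matrix (Fin d) (Fin d) ℂ) (hS : S.IsHermitian) :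
    ∃ U : Matrix (Fin d) (Fin d) ℂ, U.IsHermitian ∧ U * U = 1 ∧ (U * S).trace.re = traceNorm S := by
  set V := hS.eigenvectorUnitary with hV
  set s : Fin d → ℝ := fun i => if 0 ≤ hS.eigenvalues i then 1 else -1 with hs
  have hss : ∀ i, s i * s i = 1 := by intro i; simp only [hs]; split_ifs <;> norm_num
  have hsl : ∀ i, s i * hS.eigenvalues i = |hS.eigenvalues i| := by
    intro i; simp only [hs]; split_ifs with h
    · rw [abs_of_nonneg h, one_mul]
    · rw [abs_of_neg (not_le.1 h)]; ring
  have hUS : (V.1 * diagonal (fun i => (s i : ℂ)) * star V.1) * S =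
      V.1 * diagonal (fun i => ((|hS.eigenvalues i| : ℝ) : ℂ)) * star V.1 := by
    conv_lhs => rw [aux_spec hS]
    rw [aux_conj_mul]
    congr 3
    funext i
    rw [← hsl i]; push_cast; rfl
  refine ⟨V.1 * diagonal (fun i => (s i : ℂ)) * star V.1, aux_herm V s, ?_, ?_⟩
  · rw [aux_conj_mul]
    have : (fun i => (s i : ℂ) * (s i : ℂ)) = fun _ => 1 := by
      funext i; exact_mod_cast hss i
    rw [this, diagonal_one, Matrix.mul_one]
    exact Unitary.coe_mul_star_self V
  · rw [hUS, traceNorm]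
    refine congrArg (fun M : Matrix (Fin d) (Fin d) ℂ => M.trace.re) ?_
    refine aux_unique (aux_psd V (fun i => |hS.eigenvalues i|) fun i => abs_nonneg _)
      (aux_sqrt_psd _) ?_
    rw [aux_sqrt_mul, aux_conj_mul, hS.eq]
    have hSS : S * S = V.1 * diagonal (fun i => (hS.eigenvalues i : ℂ) * (hS.eigenvalues i : ℂ)) *
        star V.1 := by
      rw [← aux_conj_mul, ← aux_spec hS]
    rw [hSS]
    congr 3
    funext i
    exact_mod_cast abs_mul_abs_self _

theorem aux_sq_nonneg {d : ℕ} (X : Matrix (Fin d) (Fin d) ℂ) : 0 ≤ (Xᴴ * X).trace.re :=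
  (Complex.le_def.1 (Matrix.posSemidef_conjTranspose_mul_self X).trace_nonneg).1

theorem aux_Q {d : ℕ} {K X : Matrix (Fin d) (Fin d) ℂ} (hK : K.PosSemidef) (hX : X.IsHermitian) :
    0 ≤ (X * K * X * K).trace.re := by
  have hR := (aux_sqrt_psd hK).1
  have hRR := aux_sqrt_mul hK
  set R := hK.sqrt
  have h := aux_sq_nonneg (R * X * R)
  have e : ((R * X * R)ᴴ * (R * X * R)).trace = (X * K * X * K).trace := by
    rw [← hRR]
    simp only [Matrix.conjTranspose_mul, hR.eq, hX.eq]
    rw [show (R * (X * R) * (R * X * R)) = R * (X * R * (R * X * R)) by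
      simp only [Matrix.mul_assoc], Matrix.trace_mul_comm]
    simp only [Matrix.mul_assoc]
  rwa [e] at h

/-- Renner, Lemma 5.1.3: for Hermitian `S` and positive definite `σ`,
`‖S‖₁ ≤ √( tr(σ) · tr(S σ^{-1/2} S σ^{-1/2}) )`, where `σ^{-1/2}` is the inverse of
the positive semidefinite square root of `σ`. -/
theorem trace_norm_renner_bound {d : ℕ}
    (S σ : Matrix (Fin d) (Fin d) ℂ)
    (hS : S.IsHermitian) (hσ : σ.PosDef) :
    traceNorm S ≤
      Real.sqrt (σ.trace.re *
        (S * (hσ.posSemidef.sqrt)⁻¹ * S * (hσ.posSemidef.sqrt)⁻¹).trace.re) := by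
  obtain ⟨U, hU, hUU, hn⟩ := aux_sign S hS
  have hT := aux_sqrt_psd hσ.posSemidef
  have hTT := aux_sqrt_mul hσ.posSemidef
  set T := hσ.posSemidef.sqrt
  have hTu : IsUnit T.det := by
    have h : IsUnit σ.det := (Matrix.isUnit_iff_isUnit_det _).1 hσ.isUnit
    rw [← hTT, Matrix.det_mul] at h
    exact isUnit_of_mul_isUnit_left h
  have hTi : T * T⁻¹ = 1 := Matrix.mul_nonsing_inv _ hTu
  have hiT : T⁻¹ * T = 1 := Matrix.nonsing_inv_mul _ hTu
  have hK : T⁻¹.PosSemidef := hT.inv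
  set K := T⁻¹
  have hY : (T * U * T).IsHermitian := by
    rw [Matrix.IsHermitian]
    simp only [Matrix.conjTranspose_mul, hT.1.eq, hU.eq, Matrix.mul_assoc]
  have hquad : ∀ t : ℝ, 0 ≤ (T * U * T * U).trace.re * (t * t) +
      (-2 * traceNorm S) * t + (S * K * S * K).trace.re := by
    intro t
    have hX : (S - (t : ℂ) • (T * U * T)).IsHermitian := by
      refine hS.sub ?_
      rw [Matrix.IsHermitian, Matrix.conjTranspose_smul, hY.eq]
      simp
    have h := aux_Q hK hX
    have e1 : (T * U * T) * K = T * U := by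
      rw [Matrix.mul_assoc, hTi, Matrix.mul_one]
    have e2 : (S - (t : ℂ) • (T * U * T)) * K = S * K - (t : ℂ) • (T * U) := by
      rw [Matrix.sub_mul, Matrix.smul_mul, e1]
    have c1 : (S * K * (T * U)).trace = (U * S).trace := by
      rw [show S * K * (T * U) = S * (K * T) * U by simp only [Matrix.mul_assoc], hiT,
        Matrix.mul_one, Matrix.trace_mul_comm]
    have c2 : (T * U * (S * K)).trace = (U * S).trace := by
      rw [Matrix.trace_mul_comm, c1]
    have e3 : ((S - (t : ℂ) • (T * U * T)) * K * (S - (t : ℂ) • (T * U * T)) * K).trace =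
        (S * K * S * K).trace - 2 * (t : ℂ) * (U * S).trace +
          (t : ℂ) * (t : ℂ) * (T * U * T * U).trace := by
      rw [Matrix.mul_assoc (_ * K) _ K, e2, Matrix.sub_mul, Matrix.mul_sub, Matrix.mul_sub]
      simp only [Matrix.smul_mul, Matrix.mul_smul, Matrix.trace_sub, Matrix.trace_smul, c1, c2,
        smul_eq_mul]
      simp only [← Matrix.mul_assoc]
      ring
    rw [e3] at h
    have e4 : ((S * K * S * K).trace - 2 * (t : ℂ) * (U * S).trace +
          (t : ℂ) * (t : ℂ) * (T * U * T * U).trace).re =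
        (S * K * S * K).trace.re - 2 * t * (U * S).trace.re + t * t * (T * U * T * U).trace.re := by
      rw [show (2 : ℂ) * (t : ℂ) = ((2 * t : ℝ) : ℂ) by push_cast; rfl,
        show (t : ℂ) * (t : ℂ) = ((t * t : ℝ) : ℂ) by push_cast; rfl]
      simp only [Complex.add_re, Complex.sub_re, Complex.re_ofReal_mul]
    rw [e4, hn] at h
    linarith
  have hdisc := discrim_le_zero hquad
  rw [discrim] at hdisc
  have ha : 0 ≤ (S * K * S * K).trace.re := aux_Q hK hS
  have hcomm : (T * U * T * U).trace.re ≤ σ.trace.re := by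
    have h := aux_sq_nonneg (U * T - T * U)
    have e : ((U * T - T * U)ᴴ * (U * T - T * U)).trace =
        σ.trace + σ.trace - (T * U * T * U).trace - (T * U * T * U).trace := by
      simp only [Matrix.conjTranspose_sub, Matrix.conjTranspose_mul, hT.1.eq, hU.eq]
      rw [Matrix.sub_mul, Matrix.mul_sub, Matrix.mul_sub]
      simp only [Matrix.trace_sub]
      have a1 : T * U * (U * T) = σ := by
        rw [show T * U * (U * T) = T * (U * U) * T by simp only [Matrix.mul_assoc], hUU,
          Matrix.mul_one, hTT]
      have a2 : (U * T * (T * U)).trace = σ.trace := by rw [Matrix.trace_mul_comm, a1]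
      have a3 : (U * T * (U * T)).trace = (T * U * T * U).trace := by
        rw [Matrix.mul_assoc, Matrix.trace_mul_comm]
        simp only [Matrix.mul_assoc]
      rw [a1, a2, a3, ← Matrix.mul_assoc]
      ring
    rw [e] at h
    simp only [Complex.add_re, Complex.sub_re] at h
    linarith
  apply Real.le_sqrt_of_sq_le
  nlinarith [mul_le_mul_of_nonneg_right hcomm ha]
end
end

section
/- Let n ≥ 1, δ ≥ 0, let S ⊆ (ZMod 2)^n × (ZMod 2)^n be a finite nonempty δ-biased set (viewing pairs as strings in (ZMod 2)^{2n}), and let E be the Ambainis–Smith cipher associated to S. Let t be a real number, ρ a density matrix on ℂ^{2^n} ⊗ ℂ^{d_E}, and σ a positive definite density matrix on ℂ^{d_E} with ρ ≤ 2^{−t} (I_{2^n} ⊗ σ). Set ρ̃ = ρ − (I_{2^n}/2^n) ⊗ tr_A ρ. Then the (real) trace tr[ E(ρ̃) (I_{2^n} ⊗ σ^{−1/2}) E(ρ̃) (I_{2^n} ⊗ σ^{−1/2}) ] is at most δ² · 2^{−t}, where σ^{−1/2} is the inverse of the positive semidefinite square root of σ. -/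
open Matrix Kronecker ComplexOrder MatrixOrder

noncomputable section

/-- The n-qubit Pauli operator `X^u Z^v`, indexed by `(ZMod 2)^n`:
entry `(x, y)` is `(-1)^(v ⊙ y)` if `x = y + u` and `0` otherwise. -/
def pauliXZ (n : ℕ) (u v : Fin n → ZMod 2) :
    Matrix (Fin n → ZMod 2) (Fin n → ZMod 2) ℂ :=
  Matrix.of fun x y => if x = y + u then (-1 : ℂ) ^ (∑ j, v j * y j).val else 0

/-- `(-1)^z` for `z ∈ ZMod 2`. -/
def signZ (z : ZMod 2) : ℝ := if z = 0 then 1 else -1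

/-- A nonempty set `S ⊆ (ZMod 2)^n × (ZMod 2)^n` (viewed as strings of length `2n`)
is `δ`-biased if `|𝔼_{s∈S} (-1)^{s ⊙ s'}| ≤ δ` for every nonzero `s'`. -/
def DeltaBiased {n : ℕ} (δ : ℝ)
    (S : Finset ((Fin n → ZMod 2) × (Fin n → ZMod 2))) : Prop :=
  ∀ s' : (Fin n → ZMod 2) × (Fin n → ZMod 2), s' ≠ 0 →
    |(S.card : ℝ)⁻¹ *
      ∑ s ∈ S, signZ ((∑ j, s.1 j * s'.1 j) + ∑ j, s.2 j * s'.2 j)| ≤ δ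

/-- The Ambainis–Smith cipher associated to `S`:
`E(ρ) = (1/|S|) ∑_{(a,b)∈S} (X^a Z^b ⊗ I_E) ρ (X^a Z^b ⊗ I_E)†`. -/
def ASCipher {n : ℕ} {E : Type*} [Fintype E] [DecidableEq E]
    (S : Finset ((Fin n → ZMod 2) × (Fin n → ZMod 2)))
    (ρ : Matrix ((Fin n → ZMod 2) × E) ((Fin n → ZMod 2) × E) ℂ) :
    Matrix ((Fin n → ZMod 2) × E) ((Fin n → ZMod 2) × E) ℂ :=
  (S.card : ℂ)⁻¹ • ∑ s ∈ S,
    (pauliXZ n s.1 s.2 ⊗ₖ (1 : Matrix E E ℂ)) * ρ *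
      (pauliXZ n s.1 s.2 ⊗ₖ (1 : Matrix E E ℂ))ᴴ


lemma asc_sign_add (a b : ZMod 2) : signZ (a + b) = signZ a * signZ b := by
  have h : ∀ c : ZMod 2, c = 0 ∨ c = 1 := by decide
  have h2 : (1 : ZMod 2) + 1 = 0 := by decide
  rcases h a with rfl | rfl <;> rcases h b with rfl | rfl <;> simp [signZ, h2]

lemma asc_sign_pow (a : ZMod 2) : (-1 : ℂ) ^ a.val = (signZ a : ℂ) := by
  have h : ∀ c : ZMod 2, c = 0 ∨ c = 1 := by decide
  rcases h a with rfl | rfl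
  · simp [signZ]
  · have h : ((1 : ZMod 2)).val = 1 := by decide
    simp [signZ, h]

lemma asc_sign_sq (a : ZMod 2) : signZ a * signZ a = 1 := by
  unfold signZ; split_ifs <;> norm_num

lemma asc_add_self {n : ℕ} (a : Fin n → ZMod 2) : a + a = 0 := by
  funext j; exact CharTwo.add_self_eq_zero _

lemma asc_add_add {n : ℕ} (x a : Fin n → ZMod 2) : x + a + a = x := by
  rw [add_assoc, asc_add_self, add_zero]

lemma asc_eq_add_iff {n : ℕ} (x y a : Fin n → ZMod 2) : x = y + a ↔ y = x + a := by
  constructor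
  · rintro rfl; rw [asc_add_add]
  · rintro rfl; rw [asc_add_add]

lemma asc_pauli_mul {n : ℕ} {E Q : Type*} [Fintype E] [DecidableEq E]
    (a b : Fin n → ZMod 2) (M : Matrix ((Fin n → ZMod 2) × E) Q ℂ)
    (x : Fin n → ZMod 2) (e : E) (q : Q) :
    ((pauliXZ n a b ⊗ₖ (1 : Matrix E E ℂ)) * M) (x, e) q
      = (signZ (b ⬝ᵥ (x + a)) : ℂ) * M (x + a, e) q := by
  rw [Matrix.mul_apply, Fintype.sum_prod_type]
  rw [Finset.sum_eq_single (x + a)]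
  · rw [Finset.sum_eq_single e]
    · simp only [kroneckerMap_apply, pauliXZ, Matrix.of_apply, asc_add_add, if_true,
        Matrix.one_apply_eq, mul_one, asc_sign_pow]
      rfl
    · intro f _ hf
      simp [kroneckerMap_apply, Matrix.one_apply_ne hf.symm]
    · simp
  · intro y _ hy
    apply Finset.sum_eq_zero
    intro f _
    have : ¬ x = y + a := fun h => hy ((asc_eq_add_iff x y a).1 h)
    simp [kroneckerMap_apply, pauliXZ, this]
  · simp

lemma asc_conj {n : ℕ} {E : Type*} [Fintype E] [DecidableEq E]
    (a b : Fin n → ZMod 2) (M : Matrix ((Fin n → ZMod 2) × E) ((Fin n → ZMod 2) × E) ℂ)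
    (x u : Fin n → ZMod 2) (e f : E) :
    ((pauliXZ n a b ⊗ₖ (1 : Matrix E E ℂ)) * M * (pauliXZ n a b ⊗ₖ (1 : Matrix E E ℂ))ᴴ)
      (x, e) (x + u, f)
      = (signZ (b ⬝ᵥ u) : ℂ) * M (x + a, e) (x + a + u, f) := by
  have h : (pauliXZ n a b ⊗ₖ (1 : Matrix E E ℂ)) * M * (pauliXZ n a b ⊗ₖ (1 : Matrix E E ℂ))ᴴ
     = ((pauliXZ n a b ⊗ₖ (1 : Matrix E E ℂ)) *
        ((pauliXZ n a b ⊗ₖ (1 : Matrix E E ℂ)) * M)ᴴ)ᴴ := by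
    rw [Matrix.conjTranspose_mul, Matrix.conjTranspose_conjTranspose]
  rw [h, Matrix.conjTranspose_apply, asc_pauli_mul, Matrix.conjTranspose_apply, asc_pauli_mul]
  have h2 : x + u + a = x + a + u := by abel
  rw [h2, dotProduct_add b (x + a) u, asc_sign_add]
  have h3 := asc_sign_sq (b ⬝ᵥ (x + a))
  have h4 : (signZ (b ⬝ᵥ (x + a)) : ℂ) * (signZ (b ⬝ᵥ (x + a)) : ℂ) = 1 := by
    exact_mod_cast h3
  simp only [star_mul', star_star, Complex.ofReal_mul]
  simp only [Complex.star_def, Complex.conj_ofReal]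
  linear_combination (signZ (b ⬝ᵥ u) : ℂ) * M (x + a, e) (x + a + u, f) * h4

lemma asc_cipher_apply {n : ℕ} {E : Type*} [Fintype E] [DecidableEq E]
    (S : Finset ((Fin n → ZMod 2) × (Fin n → ZMod 2)))
    (M : Matrix ((Fin n → ZMod 2) × E) ((Fin n → ZMod 2) × E) ℂ)
    (x u : Fin n → ZMod 2) (e f : E) :
    ASCipher S M (x, e) (x + u, f)
      = (S.card : ℂ)⁻¹ * ∑ s ∈ S, (signZ (s.2 ⬝ᵥ u) : ℂ) * M (x + s.1, e) (x + s.1 + u, f) := by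
  unfold ASCipher
  rw [Matrix.smul_apply, Matrix.sum_apply, smul_eq_mul]
  simp only [asc_conj]

/-- Fourier transform on bit strings -/
def ascHat {n : ℕ} (F : (Fin n → ZMod 2) → ℂ) (v : Fin n → ZMod 2) : ℂ :=
  ∑ x, (signZ (v ⬝ᵥ x) : ℂ) * F x

lemma asc_orth {n : ℕ} (z : Fin n → ZMod 2) :
    ∑ v : Fin n → ZMod 2, (signZ (v ⬝ᵥ z) : ℂ) = if z = 0 then (2 : ℂ) ^ n else 0 := by
  split_ifs with h
  · subst h
    simp [signZ]
  · obtain ⟨j, hj⟩ : ∃ j, z j ≠ 0 := by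
      by_contra hh
      push Not at hh
      exact h (funext hh)
    have hj1 : z j = 1 := by
      revert hj; generalize z j = c; revert c; decide
    have h1 := Equiv.sum_comp (Equiv.addRight (Pi.single j (1 : ZMod 2)))
      (fun v : Fin n → ZMod 2 => (signZ (v ⬝ᵥ z) : ℂ))
    have h2 : ∀ v : Fin n → ZMod 2,
        (signZ ((Equiv.addRight (Pi.single j (1 : ZMod 2)) v) ⬝ᵥ z) : ℂ)
          = - (signZ (v ⬝ᵥ z) : ℂ) := by
      intro v
      rw [Equiv.coe_addRight, add_dotProduct, single_dotProduct, hj1, asc_sign_add]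
      simp [signZ]
    simp only [h2, Finset.sum_neg_distrib] at h1
    linear_combination (-1/2 : ℂ) * h1

lemma asc_parseval {n : ℕ} (F : (Fin n → ZMod 2) → ℂ) :
    ∑ v, ‖ascHat F v‖ ^ 2 = 2 ^ n * ∑ x, ‖F x‖ ^ 2 := by
  have key : ∑ v, ascHat F v * star (ascHat F v) = 2 ^ n * ∑ x, F x * star (F x) := by
    have h1 : ∀ v, ascHat F v * star (ascHat F v)
        = ∑ x, ∑ y, (F x * star (F y)) * (signZ (v ⬝ᵥ (x + y)) : ℂ) := by
      intro v
      unfold ascHat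
      rw [star_sum, Finset.sum_mul_sum]
      refine Finset.sum_congr rfl fun x _ => Finset.sum_congr rfl fun y _ => ?_
      rw [dotProduct_add, asc_sign_add]
      simp only [star_mul', Complex.ofReal_mul]
      simp only [Complex.star_def, Complex.conj_ofReal]
      ring
    simp only [h1]
    rw [Finset.sum_comm, Finset.mul_sum]
    refine Finset.sum_congr rfl fun x _ => ?_
    rw [Finset.sum_comm]
    simp only [← Finset.mul_sum, asc_orth]
    rw [Finset.sum_eq_single x]
    · rw [asc_add_self, if_pos rfl]; ring
    · intro y _ hy
      rw [if_neg, mul_zero]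
      intro h
      apply hy
      have := (asc_eq_add_iff 0 x y).1 (by rw [h])
      rw [this, zero_add]
    · simp
  simp only [Complex.star_def, Complex.mul_conj, Complex.normSq_eq_norm_sq] at key
  exact_mod_cast key

lemma asc_hat_shift {n : ℕ} (F : (Fin n → ZMod 2) → ℂ) (a v : Fin n → ZMod 2) :
    ascHat (fun x => F (x + a)) v = (signZ (a ⬝ᵥ v) : ℂ) * ascHat F v := by
  unfold ascHat
  rw [← Equiv.sum_comp (Equiv.addRight a), Finset.mul_sum]
  refine Finset.sum_congr rfl fun x _ => ?_
  simp only [Equiv.coe_addRight, asc_add_add]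
  rw [dotProduct_add, asc_sign_add, dotProduct_comm v a]
  push_cast
  ring

lemma asc_hat_cipher {n : ℕ} {E : Type*} [Fintype E] [DecidableEq E]
    (S : Finset ((Fin n → ZMod 2) × (Fin n → ZMod 2)))
    (M : Matrix ((Fin n → ZMod 2) × E) ((Fin n → ZMod 2) × E) ℂ)
    (u v : Fin n → ZMod 2) (e f : E) :
    ascHat (fun x => ASCipher S M (x, e) (x + u, f)) v
      = (((S.card : ℝ)⁻¹ * ∑ s ∈ S, signZ (s.1 ⬝ᵥ v + s.2 ⬝ᵥ u) : ℝ) : ℂ) *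
        ascHat (fun x => M (x, e) (x + u, f)) v := by
  have h : ascHat (fun x => ASCipher S M (x, e) (x + u, f)) v
      = (S.card : ℂ)⁻¹ * ∑ s ∈ S, (signZ (s.2 ⬝ᵥ u) : ℂ) *
        ascHat (fun x => (fun x => M (x, e) (x + u, f)) (x + s.1)) v := by
    simp only [asc_cipher_apply, ascHat, Finset.mul_sum]
    rw [Finset.sum_comm]
    refine Finset.sum_congr rfl fun x _ => Finset.sum_congr rfl fun y _ => ?_
    ring
  rw [h]
  have hsh : ∀ s : (Fin n → ZMod 2) × (Fin n → ZMod 2),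
      ascHat (fun x => (fun x => M (x, e) (x + u, f)) (x + s.1)) v
        = (signZ (s.1 ⬝ᵥ v) : ℂ) * ascHat (fun x => M (x, e) (x + u, f)) v :=
    fun s => asc_hat_shift (fun x => M (x, e) (x + u, f)) s.1 v
  rw [Finset.sum_congr rfl fun s _ => congrArg _ (hsh s)]
  push_cast
  rw [mul_assoc, Finset.sum_mul]
  congr 1
  refine Finset.sum_congr rfl fun s _ => ?_
  rw [asc_sign_add]
  push_cast
  ring

lemma asc_scalar {n : ℕ} {E : Type*} [Fintype E] [DecidableEq E] (δ : ℝ) (hδ : 0 ≤ δ)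
    (S : Finset ((Fin n → ZMod 2) × (Fin n → ZMod 2))) (hbias : DeltaBiased δ S)
    (M : Matrix ((Fin n → ZMod 2) × E) ((Fin n → ZMod 2) × E) ℂ)
    (u : Fin n → ZMod 2) (e f : E) :
    ∑ x, ‖ASCipher S (M - ((2 : ℂ) ^ n)⁻¹ •
            ((1 : Matrix (Fin n → ZMod 2) (Fin n → ZMod 2) ℂ) ⊗ₖ ptraceA M)) (x, e) (x + u, f)‖ ^ 2
      ≤ δ ^ 2 * ∑ x, ‖M (x, e) (x + u, f)‖ ^ 2 := by
  have hpos : (0 : ℝ) < 2 ^ n := by positivity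
  refine le_of_mul_le_mul_left ?_ hpos
  rw [mul_left_comm, ← asc_parseval, ← asc_parseval (fun x => M (x, e) (x + u, f)),
    Finset.mul_sum]
  refine Finset.sum_le_sum fun v _ => ?_
  rw [asc_hat_cipher]
  set D : ℂ := ((2 : ℂ) ^ n)⁻¹ * ((1 : Matrix (Fin n → ZMod 2) (Fin n → ZMod 2) ℂ) 0 u
    * ptraceA M e f) with hD
  have hN : ascHat (fun x => (M - ((2 : ℂ) ^ n)⁻¹ •
      ((1 : Matrix (Fin n → ZMod 2) (Fin n → ZMod 2) ℂ) ⊗ₖ ptraceA M)) (x, e) (x + u, f)) v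
      = ascHat (fun x => M (x, e) (x + u, f)) v - (if v = 0 then (2 : ℂ) ^ n else 0) * D := by
    rw [← asc_orth]
    unfold ascHat
    rw [Finset.sum_mul, ← Finset.sum_sub_distrib]
    refine Finset.sum_congr rfl fun x _ => ?_
    have h1 : (1 : Matrix (Fin n → ZMod 2) (Fin n → ZMod 2) ℂ) x (x + u)
        = (1 : Matrix (Fin n → ZMod 2) (Fin n → ZMod 2) ℂ) 0 u := by
      simp [Matrix.one_apply, eq_comm]
    beta_reduce
    rw [Matrix.sub_apply, Matrix.smul_apply, kroneckerMap_apply, smul_eq_mul, h1, ← hD,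
      dotProduct_comm v x]
    ring
  rw [hN]
  by_cases huv : v = 0 ∧ u = 0
  · obtain ⟨rfl, rfl⟩ := huv
    have h0 : ascHat (fun x => M (x, e) (x + 0, f)) 0 = ptraceA M e f := by
      simp [ascHat, ptraceA, signZ]
    have h2 : (2 : ℂ) ^ n ≠ 0 := by positivity
    have hz : ascHat (fun x => M (x, e) (x + 0, f)) 0
       - (if (0 : Fin n → ZMod 2) = 0 then (2 : ℂ) ^ n else 0) * D = 0 := by
      rw [h0, hD, if_pos rfl, Matrix.one_apply_eq, one_mul, ← mul_assoc, mul_inv_cancel₀ h2,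
        one_mul, sub_self]
    rw [hz, mul_zero, norm_zero, zero_pow two_ne_zero]
    exact mul_nonneg (sq_nonneg _) (sq_nonneg _)
  · have hz : (if v = 0 then (2 : ℂ) ^ n else 0) * D = 0 := by
      by_cases hv : v = 0
      · have hu : u ≠ 0 := fun h => huv ⟨hv, h⟩
        rw [hD, Matrix.one_apply_ne hu.symm]; simp
      · simp [hv]
    rw [hz, sub_zero, norm_mul, mul_pow, Complex.norm_real, Real.norm_eq_abs]
    have hb := hbias (v, u) (by
      intro h
      exact huv ⟨congrArg Prod.fst h, congrArg Prod.snd h⟩)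
    have hb' : |(S.card : ℝ)⁻¹ * ∑ s ∈ S, signZ (s.1 ⬝ᵥ v + s.2 ⬝ᵥ u)| ≤ δ := hb
    gcongr

lemma asc_sum_re {n : ℕ} {E : Type*} [Fintype E]
    (g : ((Fin n → ZMod 2) × E) → ((Fin n → ZMod 2) × E) → ℝ) :
    ∑ p, ∑ q, g p q = ∑ e, ∑ f, ∑ u, ∑ x, g (x, e) (x + u, f) := by
  simp only [Fintype.sum_prod_type]
  rw [Finset.sum_comm]
  refine Finset.sum_congr rfl fun e _ => ?_
  have h : ∀ x : Fin n → ZMod 2, ∑ y, ∑ f, g (x, e) (y, f) = ∑ f, ∑ u, g (x, e) (x + u, f) := by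
    intro x
    rw [Finset.sum_comm]
    refine Finset.sum_congr rfl fun f _ => ?_
    exact (Equiv.sum_comp (Equiv.addLeft x) (fun y => g (x, e) (y, f))).symm
  simp only [h]
  rw [Finset.sum_comm]
  refine Finset.sum_congr rfl fun f _ => ?_
  rw [Finset.sum_comm]

lemma asc_matrix {n : ℕ} {E : Type*} [Fintype E] [DecidableEq E] (δ : ℝ) (hδ : 0 ≤ δ)
    (S : Finset ((Fin n → ZMod 2) × (Fin n → ZMod 2))) (hbias : DeltaBiased δ S)
    (M : Matrix ((Fin n → ZMod 2) × E) ((Fin n → ZMod 2) × E) ℂ) :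
    ∑ p, ∑ q, ‖ASCipher S (M - ((2 : ℂ) ^ n)⁻¹ •
            ((1 : Matrix (Fin n → ZMod 2) (Fin n → ZMod 2) ℂ) ⊗ₖ ptraceA M)) p q‖ ^ 2
      ≤ δ ^ 2 * ∑ p, ∑ q, ‖M p q‖ ^ 2 := by
  rw [asc_sum_re, asc_sum_re (fun p q => ‖M p q‖ ^ 2)]
  simp only [Finset.mul_sum]
  refine Finset.sum_le_sum fun e _ => Finset.sum_le_sum fun f _ => Finset.sum_le_sum fun u _ => ?_
  rw [← Finset.mul_sum]
  exact asc_scalar δ hδ S hbias M u e f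

lemma asc_herm_trace {d : Type*} [Fintype d] (M : Matrix d d ℂ) (h : M.IsHermitian) :
    (Matrix.trace (M * M)).re = ∑ p, ∑ q, ‖M p q‖ ^ 2 := by
  rw [Matrix.trace, Complex.re_sum]
  refine Finset.sum_congr rfl fun p _ => ?_
  rw [Matrix.diag_apply, Matrix.mul_apply, Complex.re_sum]
  refine Finset.sum_congr rfl fun q _ => ?_
  rw [← h.apply q p, Complex.star_def, Complex.mul_conj, Complex.ofReal_re,
    Complex.normSq_eq_norm_sq]

lemma asc_cipher_herm {n : ℕ} {E : Type*} [Fintype E] [DecidableEq E]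
    (S : Finset ((Fin n → ZMod 2) × (Fin n → ZMod 2)))
    (M : Matrix ((Fin n → ZMod 2) × E) ((Fin n → ZMod 2) × E) ℂ) (h : M.IsHermitian) :
    (ASCipher S M).IsHermitian := by
  unfold Matrix.IsHermitian ASCipher
  rw [Matrix.conjTranspose_smul, Matrix.conjTranspose_sum]
  have hc : star ((S.card : ℂ)⁻¹) = (S.card : ℂ)⁻¹ := by
    rw [star_inv₀, star_natCast]
  rw [hc]
  refine congrArg _ (Finset.sum_congr rfl fun s _ => ?_)
  exact Matrix.isHermitian_mul_mul_conjTranspose _ h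

lemma asc_cipher_conj {n : ℕ} {E : Type*} [Fintype E] [DecidableEq E]
    (S : Finset ((Fin n → ZMod 2) × (Fin n → ZMod 2)))
    (M : Matrix ((Fin n → ZMod 2) × E) ((Fin n → ZMod 2) × E) ℂ) (w : Matrix E E ℂ) :
    ((1 : Matrix (Fin n → ZMod 2) (Fin n → ZMod 2) ℂ) ⊗ₖ w) * ASCipher S M *
      ((1 : Matrix (Fin n → ZMod 2) (Fin n → ZMod 2) ℂ) ⊗ₖ w)
    = ASCipher S (((1 : Matrix (Fin n → ZMod 2) (Fin n → ZMod 2) ℂ) ⊗ₖ w) * M *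
      ((1 : Matrix (Fin n → ZMod 2) (Fin n → ZMod 2) ℂ) ⊗ₖ w)) := by
  unfold ASCipher
  rw [Matrix.mul_smul, Matrix.smul_mul, Matrix.mul_sum, Matrix.sum_mul]
  refine congrArg _ (Finset.sum_congr rfl fun s _ => ?_)
  set P := pauliXZ n s.1 s.2 with hP
  set W := ((1 : Matrix (Fin n → ZMod 2) (Fin n → ZMod 2) ℂ) ⊗ₖ w) with hW
  have h1 : W * (P ⊗ₖ (1 : Matrix E E ℂ)) = (P ⊗ₖ (1 : Matrix E E ℂ)) * W := by
    rw [hW, ← Matrix.mul_kronecker_mul, ← Matrix.mul_kronecker_mul]; simp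
  have h2 : (P ⊗ₖ (1 : Matrix E E ℂ))ᴴ * W = W * (P ⊗ₖ (1 : Matrix E E ℂ))ᴴ := by
    rw [hW, Matrix.conjTranspose_kronecker, ← Matrix.mul_kronecker_mul,
      ← Matrix.mul_kronecker_mul]; simp
  calc W * ((P ⊗ₖ (1 : Matrix E E ℂ)) * M * (P ⊗ₖ (1 : Matrix E E ℂ))ᴴ) * W
      = (W * (P ⊗ₖ (1 : Matrix E E ℂ))) * M * ((P ⊗ₖ (1 : Matrix E E ℂ))ᴴ * W) := by
        simp only [Matrix.mul_assoc]
    _ = _ := by rw [h1, h2]; simp only [Matrix.mul_assoc]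

lemma asc_ptrace_conj {A E : Type*} [Fintype A] [DecidableEq A] [Fintype E] [DecidableEq E]
    (M : Matrix (A × E) (A × E) ℂ) (w : Matrix E E ℂ) :
    ptraceA (((1 : Matrix A A ℂ) ⊗ₖ w) * M * ((1 : Matrix A A ℂ) ⊗ₖ w))
      = w * ptraceA M * w := by
  ext e f
  simp only [ptraceA, Matrix.of_apply, Matrix.mul_apply, Fintype.sum_prod_type,
    kroneckerMap_apply, Matrix.one_apply, ite_mul, one_mul, zero_mul, mul_ite, mul_zero]
  simp only [Finset.sum_mul, Finset.mul_sum, Finset.sum_ite_irrel, Finset.sum_const_zero,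
    Finset.sum_ite_eq, Finset.sum_ite_eq', Finset.mem_univ, if_true]
  rw [Finset.sum_comm]
  refine Finset.sum_congr rfl fun g _ => ?_
  rw [Finset.sum_comm]

lemma asc_trace_mul_nonneg {d : Type*} [Fintype d] [DecidableEq d] (A B : Matrix d d ℂ)
    (hA : A.PosSemidef) (hB : B.PosSemidef) : 0 ≤ (Matrix.trace (A * B)).re := by
  have h0 : CFC.sqrt A * CFC.sqrt A = A :=
    CFC.sqrt_mul_sqrt_self A (Matrix.nonneg_iff_posSemidef.2 hA)
  have h1 : (CFC.sqrt A).IsHermitian :=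
    (Matrix.nonneg_iff_posSemidef.1 (CFC.sqrt_nonneg A)).isHermitian
  generalize CFC.sqrt A = C at h0 h1
  rw [← h0, Matrix.mul_assoc, Matrix.trace_mul_comm]
  have h := (hB.mul_mul_conjTranspose_same C).trace_nonneg
  rw [h1.eq] at h
  exact (Complex.le_def.1 h).1

lemma asc_cyc {d : Type*} [Fintype d] (M W : Matrix d d ℂ)
    (hM : M.IsHermitian) (hW : W.IsHermitian) :
    (Matrix.trace (M * (W * W) * M * (W * W))).re = ∑ p, ∑ q, ‖(W * M * W) p q‖ ^ 2 := by
  have hh : (W * M * W).IsHermitian := by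
    have := Matrix.isHermitian_mul_mul_conjTranspose W hM
    rwa [hW.eq] at this
  rw [← asc_herm_trace _ hh]
  have : M * (W * W) * M * (W * W) = (M * W * (W * M * W)) * W := by
    simp only [Matrix.mul_assoc]
  rw [this, Matrix.trace_mul_comm]
  simp only [Matrix.mul_assoc]

/-- for a `δ`-biased set `S`, a density matrix `ρ` and a positive
definite density `σ` with `ρ ≤ 2^{-t}(I ⊗ σ)`, setting
`ρ̃ = ρ - (I/2^n) ⊗ tr_A ρ`, one has
`tr[E(ρ̃)(I ⊗ σ^{-1/2})E(ρ̃)(I ⊗ σ^{-1/2})] ≤ δ² 2^{-t}`. -/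
theorem ambainis_smith_two_norm_bound {n dE : ℕ} (hn : 1 ≤ n) (δ : ℝ) (hδ : 0 ≤ δ)
    (S : Finset ((Fin n → ZMod 2) × (Fin n → ZMod 2)))
    (hS : S.Nonempty) (hbias : DeltaBiased δ S) (t : ℝ)
    (ρ : Matrix ((Fin n → ZMod 2) × Fin dE) ((Fin n → ZMod 2) × Fin dE) ℂ)
    (hρ : IsDensity ρ)
    (σ : Matrix (Fin dE) (Fin dE) ℂ) (hσpd : σ.PosDef) (hσtr : σ.trace = 1)
    (hmin : LoewnerLE ρ ((((2 : ℝ) ^ (-t) : ℝ) : ℂ) •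
      ((1 : Matrix (Fin n → ZMod 2) (Fin n → ZMod 2) ℂ) ⊗ₖ σ))) :
    (Matrix.trace
        (ASCipher S (ρ - ((2 : ℂ) ^ n)⁻¹ •
            ((1 : Matrix (Fin n → ZMod 2) (Fin n → ZMod 2) ℂ) ⊗ₖ ptraceA ρ)) *
          ((1 : Matrix (Fin n → ZMod 2) (Fin n → ZMod 2) ℂ) ⊗ₖ (CFC.sqrt σ)⁻¹) *
          ASCipher S (ρ - ((2 : ℂ) ^ n)⁻¹ •
            ((1 : Matrix (Fin n → ZMod 2) (Fin n → ZMod 2) ℂ) ⊗ₖ ptraceA ρ)) *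
          ((1 : Matrix (Fin n → ZMod 2) (Fin n → ZMod 2) ℂ) ⊗ₖ (CFC.sqrt σ)⁻¹))).re
      ≤ δ ^ 2 * (2 : ℝ) ^ (-t) := by
  set I1 := (1 : Matrix (Fin n → ZMod 2) (Fin n → ZMod 2) ℂ) with hI1
  set s := CFC.sqrt σ with hs
  have hσ0 : (0 : Matrix (Fin dE) (Fin dE) ℂ) ≤ σ := Matrix.nonneg_iff_posSemidef.2 hσpd.posSemidef
  have hss : s * s = σ := CFC.sqrt_mul_sqrt_self σ hσ0
  have hsp : s.PosSemidef := Matrix.nonneg_iff_posSemidef.1 (CFC.sqrt_nonneg σ)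
  have hsu : IsUnit s.det := by
    have h1 : IsUnit σ.det := (Matrix.isUnit_iff_isUnit_det _).1 hσpd.isUnit
    rw [← hss, Matrix.det_mul] at h1
    exact isUnit_of_mul_isUnit_left h1
  set τ := s⁻¹ with hτ
  have hτp : τ.PosSemidef := hsp.inv
  have hτσ : τ * σ * τ = 1 := by
    rw [← hss, hτ, ← Matrix.mul_assoc, Matrix.nonsing_inv_mul _ hsu, Matrix.one_mul,
      Matrix.mul_nonsing_inv _ hsu]
  obtain ⟨w, hwh, hww⟩ : ∃ w : Matrix (Fin dE) (Fin dE) ℂ, w.IsHermitian ∧ w * w = τ :=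
    ⟨CFC.sqrt τ, (Matrix.nonneg_iff_posSemidef.1 (CFC.sqrt_nonneg τ)).isHermitian,
      CFC.sqrt_mul_sqrt_self τ (Matrix.nonneg_iff_posSemidef.2 hτp)⟩
  set W := I1 ⊗ₖ w with hW
  have hWW : I1 ⊗ₖ τ = W * W := by
    rw [hW, ← Matrix.mul_kronecker_mul, hww, hI1, Matrix.one_mul]
  have hWh : W.IsHermitian := by
    unfold Matrix.IsHermitian
    rw [hW, Matrix.conjTranspose_kronecker, hwh.eq, hI1, Matrix.conjTranspose_one]
  have hcyc : ∀ M : Matrix ((Fin n → ZMod 2) × Fin dE) ((Fin n → ZMod 2) × Fin dE) ℂ,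
      M.IsHermitian → (Matrix.trace (M * (I1 ⊗ₖ τ) * M * (I1 ⊗ₖ τ))).re
        = ∑ p, ∑ q, ‖(W * M * W) p q‖ ^ 2 := by
    intro M hM
    rw [hWW]
    exact asc_cyc M W hM hWh
  have hρh : ρ.IsHermitian := hρ.1.isHermitian
  have hNeq : W * (ρ - ((2 : ℂ) ^ n)⁻¹ • (I1 ⊗ₖ ptraceA ρ)) * W
      = W * ρ * W - ((2 : ℂ) ^ n)⁻¹ • (I1 ⊗ₖ ptraceA (W * ρ * W)) := by
    rw [hW, hI1, asc_ptrace_conj, Matrix.mul_sub, Matrix.sub_mul, Matrix.mul_smul,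
      Matrix.smul_mul, ← Matrix.mul_kronecker_mul, ← Matrix.mul_kronecker_mul]
    simp
  have hph : (ptraceA ρ).IsHermitian := by
    ext e f
    simp only [ptraceA, Matrix.conjTranspose_apply, Matrix.of_apply, star_sum]
    exact Finset.sum_congr rfl fun a _ => hρh.apply _ _
  have hNh : (ρ - ((2 : ℂ) ^ n)⁻¹ • (I1 ⊗ₖ ptraceA ρ)).IsHermitian := by
    refine hρh.sub ?_
    unfold Matrix.IsHermitian
    rw [Matrix.conjTranspose_smul, Matrix.conjTranspose_kronecker, hph.eq, hI1,
      Matrix.conjTranspose_one]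
    have hc : star (((2 : ℂ) ^ n)⁻¹) = ((2 : ℂ) ^ n)⁻¹ := by
      rw [star_inv₀, star_pow, star_ofNat]
    rw [hc]
  rw [hcyc _ (asc_cipher_herm S _ hNh), hW, hI1, asc_cipher_conj, ← hI1, ← hW, hNeq]
  refine (asc_matrix δ hδ S hbias (W * ρ * W)).trans ?_
  refine mul_le_mul_of_nonneg_left ?_ (sq_nonneg δ)
  rw [← hcyc ρ hρh]
  set T := I1 ⊗ₖ τ with hT
  have hTh : Tᴴ = T := by rw [hWW, Matrix.conjTranspose_mul, hWh.eq]
  have hTp : (T * ρ * T).PosSemidef := by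
    have := hρ.1.mul_mul_conjTranspose_same T
    rwa [hTh] at this
  have hge := asc_trace_mul_nonneg _ _ hmin hTp
  have hTσ : T * (I1 ⊗ₖ σ) * T = 1 := by
    rw [hT, ← Matrix.mul_kronecker_mul, ← Matrix.mul_kronecker_mul, hτσ, hI1, Matrix.one_mul,
      Matrix.one_mul, Matrix.one_kronecker_one]
  have htr : Matrix.trace ((I1 ⊗ₖ σ) * (T * ρ * T)) = 1 := by
    rw [← hρ.2]
    calc Matrix.trace ((I1 ⊗ₖ σ) * (T * ρ * T))
        = Matrix.trace (((I1 ⊗ₖ σ) * T) * (ρ * T)) := by simp only [Matrix.mul_assoc]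
      _ = Matrix.trace (ρ * (T * (I1 ⊗ₖ σ) * T)) := by
          rw [Matrix.trace_mul_comm]; simp only [Matrix.mul_assoc]
      _ = _ := by rw [hTσ, Matrix.mul_one]
  rw [Matrix.sub_mul, Matrix.trace_sub, Matrix.smul_mul, Matrix.trace_smul, htr,
    smul_eq_mul, mul_one, Complex.sub_re, Complex.ofReal_re] at hge
  have : ρ * T * ρ * T = ρ * (T * ρ * T) := by simp only [Matrix.mul_assoc]
  rw [this]
  linarith
end
end

section
/- (Violation of indistinguishability yields violation of entropic security.) Let n ≥ 1, let t be a real number with t ≤ n − 1, let ε ≥ 0, and let E be a CPTP map from 2^n × 2^n matrices to d' × d' matrices. Let ρ be a density matrix on ℂ^{2^n} ⊗ ℂ^{d_E} for which there exists a density matrix σ on ℂ^{d_E} with ρ ≤ 2^{−(t−1)}(I_{2^n} ⊗ σ), and suppose ‖ (E ⊗ id)(ρ) − E(I_{2^n}/2^n) ⊗ tr_A ρ ‖₁ > 6ε. Then there exists a POVM (A₁, A₂, A₃) with three outcomes on ℂ^{d'} ⊗ ℂ^{d_E} such that (1/3)·tr[A₁ (E ⊗ id)(ρ)] + (1/3)·tr[(A₂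 + A₃)(E(I_{2^n}/2^n) ⊗ tr_A ρ)] > 1/3 + ε. (This POVM predicts the index i in the interpretation ρ̂ = (1/3)ρ + (2/3)(I_{2^n}/2^n) ⊗ tr_A ρ with probability exceeding by more than ε the probability 1/3 attainable by any adversary seeing only the E system.) -/
open Matrix Kronecker ComplexOrder

noncomputable section

def conjD {d : Type*} [Fintype d] [DecidableEq d] (U : Matrix.unitaryGroup d ℂ) (f : d → ℝ) :
    Matrix d d ℂ :=
  U.1 * diagonal (fun i => ((f i : ℝ) : ℂ)) * (U.1)ᴴ

theorem conjD_mul {d : Type*} [Fintype d] [DecidableEq d] (U : Matrix.unitaryGroup d ℂ)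
    (f g : d → ℝ) : conjD U f * conjD U g = conjD U (fun i => f i * g i) := by
  have hU : (U.1)ᴴ * U.1 = 1 := by
    have := Unitary.coe_star_mul_self U
    simpa [star_eq_conjTranspose] using this
  unfold conjD
  have : diagonal (fun i => ((f i * g i : ℝ) : ℂ)) =
      diagonal (fun i => ((f i : ℝ) : ℂ)) * diagonal (fun i => ((g i : ℝ) : ℂ)) := by
    rw [diagonal_mul_diagonal]; simp
  rw [this]
  calc _ = U.1 * diagonal (fun i => ((f i : ℝ) : ℂ)) * ((U.1)ᴴ * U.1) *
        diagonal (fun i => ((g i : ℝ) : ℂ)) * (U.1)ᴴ := by simp only [Matrix.mul_assoc]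
    _ = _ := by rw [hU]; simp only [Matrix.mul_assoc, Matrix.one_mul]

theorem conjD_trace {d : Type*} [Fintype d] [DecidableEq d] (U : Matrix.unitaryGroup d ℂ)
    (f : d → ℝ) : (conjD U f).trace = ((∑ i, f i : ℝ) : ℂ) := by
  have hU : (U.1)ᴴ * U.1 = 1 := by
    have := Unitary.coe_star_mul_self U
    simpa [star_eq_conjTranspose] using this
  unfold conjD
  rw [Matrix.trace_mul_comm, ← Matrix.mul_assoc, hU, Matrix.one_mul, trace_diagonal]
  simp

theorem conjD_psd {d : Type*} [Fintype d] [DecidableEq d] (U : Matrix.unitaryGroup d ℂ)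
    (f : d → ℝ) (hf : ∀ i, 0 ≤ f i) : (conjD U f).PosSemidef := by
  unfold conjD
  apply PosSemidef.mul_mul_conjTranspose_same
  apply PosSemidef.diagonal
  intro i
  simpa using hf i

theorem conjD_one_sub {d : Type*} [Fintype d] [DecidableEq d] (U : Matrix.unitaryGroup d ℂ)
    (f : d → ℝ) : 1 - conjD U f = conjD U (fun i => 1 - f i) := by
  have hU : U.1 * (U.1)ᴴ = 1 := by
    have := Unitary.coe_mul_star_self U
    simpa [star_eq_conjTranspose] using this
  unfold conjD
  have : diagonal (fun i => ((1 - f i : ℝ) : ℂ)) =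
      1 - diagonal (fun i => ((f i : ℝ) : ℂ)) := by
    rw [← diagonal_one, diagonal_sub]; simp
  rw [this, Matrix.mul_sub, Matrix.sub_mul, Matrix.mul_one, hU]

theorem herm_eq_conjD {d : Type*} [Fintype d] [DecidableEq d] {M : Matrix d d ℂ}
    (h : M.IsHermitian) : M = conjD h.eigenvectorUnitary h.eigenvalues := by
  conv_lhs => rw [h.spectral_theorem, Unitary.conjStarAlgAut_apply]
  rfl

theorem sqrt_eq_conjD {d : Type*} [Fintype d] [DecidableEq d] {M : Matrix d d ℂ}
    (h : M.PosSemidef) :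
    h.sqrt = conjD h.1.eigenvectorUnitary (fun i => Real.sqrt (h.1.eigenvalues i)) := rfl

open scoped MatrixOrder in
theorem psd_sq_unique {d : Type*} [Fintype d] [DecidableEq d] {P Q : Matrix d d ℂ}
    (hP : P.PosSemidef) (hQ : Q.PosSemidef) (h : P * P = Q * Q) : P = Q :=
  (CFC.mul_self_eq_mul_self_iff P Q hP.nonneg hQ.nonneg).1 h

theorem traceNorm_herm {d : Type*} [Fintype d] [DecidableEq d] {M : Matrix d d ℂ}
    (h : M.IsHermitian) : traceNorm M = ∑ i, |h.eigenvalues i| := by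
  unfold traceNorm
  set hp := Matrix.posSemidef_conjTranspose_mul_self M
  have e : hp.sqrt = conjD h.eigenvectorUnitary (fun i => |h.eigenvalues i|) := by
    apply psd_sq_unique
    · rw [sqrt_eq_conjD]; exact conjD_psd _ _ fun i => Real.sqrt_nonneg _
    · exact conjD_psd _ _ fun i => abs_nonneg _
    · rw [sqrt_eq_conjD, conjD_mul, conjD_mul]
      have h1 : (fun i => √(hp.1.eigenvalues i) * √(hp.1.eigenvalues i)) = hp.1.eigenvalues := by
        funext i; exact Real.mul_self_sqrt (hp.eigenvalues_nonneg i)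
      rw [h1, ← herm_eq_conjD hp.1, h.eq]
      simp only [abs_mul_abs_self]
      rw [← conjD_mul, ← herm_eq_conjD h]
  rw [e, conjD_trace, Complex.ofReal_re]

theorem exists_test {d : Type*} [Fintype d] [DecidableEq d] {M : Matrix d d ℂ}
    (h : M.IsHermitian) (h0 : M.trace = 0) :
    ∃ A : Matrix d d ℂ, A.PosSemidef ∧ (1 - A).PosSemidef ∧
      (A * M).trace.re = traceNorm M / 2 := by
  refine ⟨conjD h.eigenvectorUnitary (fun i => if 0 < h.eigenvalues i then 1 else 0),
    conjD_psd _ _ fun i => by split_ifs <;> simp, ?_, ?_⟩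
  · rw [conjD_one_sub]
    exact conjD_psd _ _ fun i => by split_ifs <;> simp
  · have h1 : ∑ i, h.eigenvalues i = 0 := by
      have := conjD_trace h.eigenvectorUnitary h.eigenvalues
      rw [← herm_eq_conjD h, h0] at this
      exact_mod_cast this.symm
    have h2 : (conjD h.eigenvectorUnitary (fun i => if 0 < h.eigenvalues i then 1 else 0) * M) =
        conjD h.eigenvectorUnitary
          (fun i => (if 0 < h.eigenvalues i then 1 else 0) * h.eigenvalues i) := by
      rw [← conjD_mul, ← herm_eq_conjD h]
    rw [h2, conjD_trace, Complex.ofReal_re, traceNorm_herm h]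
    have h3 : ∑ i, (if 0 < h.eigenvalues i then 1 else 0) * h.eigenvalues i =
        ∑ i, (|h.eigenvalues i| + h.eigenvalues i) / 2 := by
      refine Finset.sum_congr rfl fun i _ => ?_
      split_ifs with hi
      · rw [abs_of_pos hi]; ring
      · rw [abs_of_nonpos (not_lt.1 hi)]; ring
    rw [h3, ← Finset.sum_div, Finset.sum_add_distrib, h1, add_zero]

theorem kraus_trace {a b J : Type*} [Fintype a] [DecidableEq a] [Fintype b] [Fintype J]
    (K : J → Matrix b a ℂ) (hK : ∑ j, (K j)ᴴ * K j = 1) (X : Matrix a a ℂ) :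
    (∑ j, K j * X * (K j)ᴴ).trace = X.trace := by
  rw [trace_sum]
  have : ∀ j, (K j * X * (K j)ᴴ).trace = ((K j)ᴴ * K j * X).trace := fun j => by
    rw [Matrix.trace_mul_comm, Matrix.mul_assoc]
  simp only [this]
  rw [← trace_sum, ← Finset.sum_mul, hK, Matrix.one_mul]

theorem kraus_herm {a b J : Type*} [Fintype a] [Fintype b] [Fintype J]
    (K : J → Matrix b a ℂ) {X : Matrix a a ℂ} (hX : X.IsHermitian) :
    (∑ j, K j * X * (K j)ᴴ).IsHermitian := by
  unfold Matrix.IsHermitian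
  rw [conjTranspose_sum]
  refine Finset.sum_congr rfl fun j _ => ?_
  simp [Matrix.conjTranspose_mul, hX.eq, Matrix.mul_assoc]

/-- a violation of indistinguishability yields a violation of
entropic security. If `ρ ≤ 2^{-(t-1)}(I ⊗ σ)` for some density `σ`, `t ≤ n - 1`
and `‖(E ⊗ id)(ρ) - E(I/2^n) ⊗ tr_A ρ‖₁ > 6ε`, then there is a three-outcome
POVM `(A₁, A₂, A₃)` with
`(1/3) tr[A₁ (E ⊗ id)(ρ)] + (1/3) tr[(A₂ + A₃)(E(I/2^n) ⊗ tr_A ρ)] > 1/3 + ε`. -/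
theorem indistinguishability_violation_gives_security_violation
    {n dE d' : ℕ} (hn : 1 ≤ n) (t ε : ℝ) (ht : t ≤ (n : ℝ) - 1) (hε : 0 ≤ ε)
    {J0 : Type*} [Fintype J0]
    (N : J0 → Matrix (Fin d') (Fin (2 ^ n)) ℂ)
    (hN : ∑ j, (N j)ᴴ * N j = 1)
    (ρ : Matrix (Fin (2 ^ n) × Fin dE) (Fin (2 ^ n) × Fin dE) ℂ) (hρ : IsDensity ρ)
    (hmin : ∃ σ : Matrix (Fin dE) (Fin dE) ℂ, IsDensity σ ∧
      LoewnerLE ρ ((((2 : ℝ) ^ (-(t - 1)) : ℝ) : ℂ) •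
        ((1 : Matrix (Fin (2 ^ n)) (Fin (2 ^ n)) ℂ) ⊗ₖ σ)))
    (hviol : 6 * ε < traceNorm
        ((∑ j, (N j ⊗ₖ (1 : Matrix (Fin dE) (Fin dE) ℂ)) * ρ *
            (N j ⊗ₖ (1 : Matrix (Fin dE) (Fin dE) ℂ))ᴴ)
          - (∑ j, N j * (((2 : ℂ) ^ n)⁻¹ • (1 : Matrix (Fin (2 ^ n)) (Fin (2 ^ n)) ℂ)) *
              (N j)ᴴ) ⊗ₖ ptraceA ρ)) :
    ∃ A1 A2 A3 : Matrix (Fin d' × Fin dE) (Fin d' × Fin dE) ℂ,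
      A1.PosSemidef ∧ A2.PosSemidef ∧ A3.PosSemidef ∧ A1 + A2 + A3 = 1 ∧
      1 / 3 + ε <
        (1 / 3) * (Matrix.trace (A1 *
            (∑ j, (N j ⊗ₖ (1 : Matrix (Fin dE) (Fin dE) ℂ)) * ρ *
              (N j ⊗ₖ (1 : Matrix (Fin dE) (Fin dE) ℂ))ᴴ))).re
        + (1 / 3) * (Matrix.trace ((A2 + A3) *
            ((∑ j, N j * (((2 : ℂ) ^ n)⁻¹ • (1 : Matrix (Fin (2 ^ n)) (Fin (2 ^ n)) ℂ)) *
              (N j)ᴴ) ⊗ₖ ptraceA ρ))).re := by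
  classical
  set X := (∑ j, (N j ⊗ₖ (1 : Matrix (Fin dE) (Fin dE) ℂ)) * ρ *
              (N j ⊗ₖ (1 : Matrix (Fin dE) (Fin dE) ℂ))ᴴ) with hX
  set Z := (∑ j, N j * (((2 : ℂ) ^ n)⁻¹ • (1 : Matrix (Fin (2 ^ n)) (Fin (2 ^ n)) ℂ)) *
              (N j)ᴴ) with hZ
  have hXt : X.trace = 1 := by
    rw [hX, kraus_trace, hρ.2]
    have : ∀ j, (N j ⊗ₖ (1 : Matrix (Fin dE) (Fin dE) ℂ))ᴴ *
        (N j ⊗ₖ (1 : Matrix (Fin dE) (Fin dE) ℂ)) = ((N j)ᴴ * N j) ⊗ₖ 1 := fun j => by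
      rw [conjTranspose_kronecker, ← mul_kronecker_mul]; simp
    simp only [this]
    have h2 : ∑ j, ((N j)ᴴ * N j) ⊗ₖ (1 : Matrix (Fin dE) (Fin dE) ℂ) =
        (∑ j, (N j)ᴴ * N j) ⊗ₖ 1 := by
      ext x y
      simp [Matrix.sum_apply, kroneckerMap_apply, Finset.sum_mul]
    rw [h2, hN, one_kronecker_one]
  have hZt : Z.trace = 1 := by
    rw [hZ, kraus_trace N hN]
    simp
  have hPt : (ptraceA ρ).trace = 1 := by
    rw [← hρ.2]
    simp only [ptraceA, Matrix.trace, Matrix.diag, Matrix.of_apply, Fintype.sum_prod_type]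
    exact Finset.sum_comm
  have hYt : (Z ⊗ₖ ptraceA ρ).trace = 1 := by
    rw [trace_kronecker, hZt, hPt, one_mul]
  have hXh : X.IsHermitian := kraus_herm _ hρ.1.1
  have hZh : Z.IsHermitian := by
    apply kraus_herm
    unfold Matrix.IsHermitian
    simp
  have hPh : (ptraceA ρ).IsHermitian := by
    ext i j
    simp only [ptraceA, conjTranspose_apply, Matrix.of_apply, star_sum]
    exact Finset.sum_congr rfl fun a _ => hρ.1.1.apply _ _
  have hYh : (Z ⊗ₖ ptraceA ρ).IsHermitian := by
    unfold Matrix.IsHermitian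
    rw [conjTranspose_kronecker, hZh.eq, hPh.eq]
  obtain ⟨A, hA, hA', hAt⟩ := exists_test (hXh.sub hYh) (by rw [trace_sub, hXt, hYt, sub_self])
  refine ⟨A, 1 - A, 0, hA, hA', PosSemidef.zero, by simp, ?_⟩
  rw [Matrix.mul_sub, trace_sub, Complex.sub_re] at hAt
  rw [add_zero, Matrix.sub_mul, Matrix.one_mul, trace_sub, hYt, Complex.sub_re, Complex.one_re]
  linarith
end
end

section
/- (Goldreich–Levin reduction from functions to predicates.) Let I be a finite nonempty set, (p_i)_{i∈I} nonnegative reals with ∑_i p_i = 1, m ≥ 1, f : I → (ZMod 2)^m, and for each i ∈ I let P_i and Q_i be probability distributions on (ZMod 2)^m (nonnegative functions summing to 1). Set p = ∑_i p_i · P_i(f(i)) and q = ∑_i p_i · Q_i(f(i)). If |p − q| > ε for some ε ≥ 0, then there exists r ∈ (ZMod 2)^m such that | ∑_i p_i ∑_{x : r⊙x = r⊙f(i)} P_i(x) − ∑_i p_i ∑_{x : r⊙x = r⊙f(i)} Q_i(x) | > ε/2, where r⊙x = ∑_j r_j x_j computed in ZMod 2. (Indeed, the average over all r ∈ (ZMod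 2)^m of the bracketed difference equals (p − q)/2.) -/
open Finset

lemma gl_shift {G : Type*} [AddGroup G] [Fintype G] (g : G → ℝ) (e : G) :
    ∑ r, g (r + e) = ∑ r, g r :=
  Fintype.sum_equiv (Equiv.addRight e) _ _ (fun _ => rfl)

lemma gl_count {m : ℕ} (x y : Fin m → ZMod 2) :
    ∑ r : Fin m → ZMod 2, (if ∑ j, r j * x j = ∑ j, r j * y j then (1:ℝ) else 0)
      = (Fintype.card (Fin m → ZMod 2) : ℝ) / 2 * (1 + if x = y then 1 else 0) := by
  by_cases h : x = y
  · subst h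
    simp
    ring
  · obtain ⟨k, hk⟩ := Function.ne_iff.mp h
    rw [if_neg h]
    set g : (Fin m → ZMod 2) → ℝ :=
      fun r => if ∑ j, r j * x j = ∑ j, r j * y j then (1:ℝ) else 0 with hg
    clear_value g
    obtain ⟨s, hs⟩ : ∃ s : Fin m → ZMod 2, s = Pi.single k 1 := ⟨_, rfl⟩
    have h1 : ∑ r, g (r + s) = ∑ r, g r :=
      gl_shift g _
    have h2 : ∀ r, g r + g (r + s) = 1 := by
      intro r
      have e : ∀ z : Fin m → ZMod 2,
          ∑ j, (r + s) j * z j = (∑ j, r j * z j) + z k := by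
        intro z
        simp [hs, add_mul, Finset.sum_add_distrib, Pi.single_apply]
      simp only [hg, e]
      have key : ∀ a b c d : ZMod 2, c ≠ d → ((a + c = b + d) ↔ ¬ (a = b)) := by decide
      simp only [key _ _ _ _ hk]
      split_ifs <;> simp_all
    have h3 : ∑ r, (g r + g (r + s)) = (Fintype.card (Fin m → ZMod 2) : ℝ) := by
      rw [Finset.sum_congr rfl (fun r _ => h2 r)]
      simp
    rw [Finset.sum_add_distrib, h1] at h3
    linarith

lemma gl_avg {I : Type*} [Fintype I]
    (p : I → ℝ) (hpsum : ∑ i, p i = 1) {m : ℕ} (f : I → (Fin m → ZMod 2))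
    (P : I → (Fin m → ZMod 2) → ℝ) (hPsum : ∀ i, ∑ x, P i x = 1) :
    ∑ r : Fin m → ZMod 2, (∑ i, p i * ∑ x ∈ Finset.univ.filter
            (fun x : Fin m → ZMod 2 => ∑ j, r j * x j = ∑ j, r j * f i j), P i x)
      = (Fintype.card (Fin m → ZMod 2) : ℝ) / 2 * (1 + ∑ i, p i * P i (f i)) := by
  rw [Finset.sum_comm]
  have h : ∀ i, ∑ r : Fin m → ZMod 2, (p i * ∑ x ∈ Finset.univ.filter
            (fun x : Fin m → ZMod 2 => ∑ j, r j * x j = ∑ j, r j * f i j), P i x)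
      = (Fintype.card (Fin m → ZMod 2) : ℝ) / 2 * (p i + p i * P i (f i)) := by
    intro i
    rw [← Finset.mul_sum]
    simp_rw [Finset.sum_filter]
    rw [Finset.sum_comm]
    have h2 : ∀ x, ∑ r : Fin m → ZMod 2,
        (if ∑ j, r j * x j = ∑ j, r j * f i j then P i x else 0)
        = (Fintype.card (Fin m → ZMod 2) : ℝ) / 2 * (P i x + if x = f i then P i x else 0) := by
      intro x
      have := congrArg (P i x * ·) (gl_count x (f i))
      simp only [Finset.mul_sum, mul_ite, mul_one, mul_zero] at this
      rw [this]
      split_ifs <;> ring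
    rw [Finset.sum_congr rfl (fun x _ => h2 x), ← Finset.mul_sum, Finset.sum_add_distrib, hPsum,
      Finset.sum_ite_eq' Finset.univ (f i) (P i), if_pos (Finset.mem_univ _)]
    ring
  rw [Finset.sum_congr rfl (fun i _ => h i), ← Finset.mul_sum, Finset.sum_add_distrib, hpsum]

/-- Goldreich–Levin reduction from functions to predicates:
if the weighted success probabilities `p = ∑ᵢ pᵢ Pᵢ(f(i))` and
`q = ∑ᵢ pᵢ Qᵢ(f(i))` differ by more than `ε`, then there exists `r` such that
the probabilities of predicting the predicate `x ↦ r ⊙ x` of `f(i)` differ by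
more than `ε/2`. -/
theorem goldreich_levin_reduction {I : Type*} [Fintype I] [Nonempty I]
    (p : I → ℝ) (hp : ∀ i, 0 ≤ p i) (hpsum : ∑ i, p i = 1)
    {m : ℕ} (hm : 1 ≤ m) (f : I → (Fin m → ZMod 2))
    (P Q : I → (Fin m → ZMod 2) → ℝ)
    (hPpos : ∀ i x, 0 ≤ P i x) (hPsum : ∀ i, ∑ x, P i x = 1)
    (hQpos : ∀ i x, 0 ≤ Q i x) (hQsum : ∀ i, ∑ x, Q i x = 1)
    (ε : ℝ) (hε : 0 ≤ ε)
    (hgap : |(∑ i, p i * P i (f i)) - ∑ i, p i * Q i (f i)| > ε) :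
    ∃ r : Fin m → ZMod 2,
      |(∑ i, p i * ∑ x ∈ Finset.univ.filter
            (fun x : Fin m → ZMod 2 => ∑ j, r j * x j = ∑ j, r j * f i j), P i x)
        - ∑ i, p i * ∑ x ∈ Finset.univ.filter
            (fun x : Fin m → ZMod 2 => ∑ j, r j * x j = ∑ j, r j * f i j), Q i x|
        > ε / 2 := by
  by_contra! hcon
  have hs := (Finset.abs_sum_le_sum_abs _ Finset.univ).trans
    (Finset.sum_le_sum (fun r (_ : r ∈ Finset.univ) => hcon r))
  rw [Finset.sum_sub_distrib, gl_avg p hpsum f P hPsum, gl_avg p hpsum f Q hQsum, ← mul_sub,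
    add_sub_add_left_eq_sub, abs_mul, Finset.sum_const, nsmul_eq_mul, Finset.card_univ] at hs
  have hN : (0:ℝ) < (Fintype.card (Fin m → ZMod 2) : ℝ) := by
    exact_mod_cast Fintype.card_pos
  rw [abs_of_pos (half_pos hN)] at hs
  have := mul_lt_mul_of_pos_left hgap (half_pos hN)
  linarith
end

section
/- Let n ≥ 1, let (h_i)_{i∈I} be a strongly XOR-universal family of functions from (ZMod 2)^{2n} to (ZMod 2)^n × (ZMod 2)^n indexed by a finite nonempty set I, let K ⊆ (ZMod 2)^{2n} be finite and nonempty, and let E be the associated cipher E(ρ) = (1/(|I|·|K|)) ∑_{i∈I, k∈K} |i⟩⟨i| ⊗ (X^{a_{i,k}} Z^{b_{i,k}} ⊗ I_E) ρ (X^{a_{i,k}} Z^{b_{i,k}} ⊗ I_E)† with (a_{i,k}, b_{i,k}) = h_i(k). Let t be a real number, ρ a density matrix on ℂ^{2^n} ⊗ ℂ^{d_E}, and σ a positive definite density matrix on ℂ^{d_E} with ρ ≤ 2^{−t}(I_{2^n} ⊗ σ). Set ρ̃ = ρ − (I_{2^n}/2^n) ⊗ tr_A ρ. Then the (real) trace tr[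 E(ρ̃) (I ⊗ σ^{−1/2}) E(ρ̃) (I ⊗ σ^{−1/2}) ] is at most 2^{−t}/(|I|·|K|), where I ⊗ σ^{−1/2} denotes the identity on ℂ^{|I|} ⊗ ℂ^{2^n} tensored with the inverse of the positive semidefinite square root of σ. -/
open Matrix Kronecker ComplexOrder

noncomputable section

/-- `|i⟩⟨i|`: the 0/1 diagonal matrix with a single 1 in position `(i,i)`. -/
def ketbra {I : Type*} [DecidableEq I] (i : I) : Matrix I I ℂ :=
  Matrix.of fun a b => if a = i ∧ b = i then 1 else 0

/-- A family of functions `h_i : (ZMod 2)^{2n} → (ZMod 2)^n × (ZMod 2)^n` is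
strongly XOR-universal if for every target `a` and all `x ≠ y`, the number of
indices `i` with `h_i(x) - h_i(y) = a` is exactly `|I| / 2^{2n}`. -/
def StronglyXORUniversal {n : ℕ} {I : Type*} [Fintype I]
    (h : I → (Fin (2 * n) → ZMod 2) → (Fin n → ZMod 2) × (Fin n → ZMod 2)) : Prop :=
  ∀ a : (Fin n → ZMod 2) × (Fin n → ZMod 2), ∀ x y : Fin (2 * n) → ZMod 2, x ≠ y →
    (Finset.univ.filter fun i => h i x - h i y = a).card * 2 ^ (2 * n) = Fintype.card I

/-- The XOR-universal cipher:
`E(ρ) = (1/(|I||K|)) ∑_{i,k} |i⟩⟨i| ⊗ (X^a Z^b ⊗ I) ρ (X^a Z^b ⊗ I)†` with `(a,b) = h_i(k)`. -/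
def XORCipher {n : ℕ} {I : Type*} [Fintype I] [DecidableEq I]
    {E : Type*} [Fintype E] [DecidableEq E]
    (h : I → (Fin (2 * n) → ZMod 2) → (Fin n → ZMod 2) × (Fin n → ZMod 2))
    (K : Finset (Fin (2 * n) → ZMod 2))
    (ρ : Matrix ((Fin n → ZMod 2) × E) ((Fin n → ZMod 2) × E) ℂ) :
    Matrix (I × ((Fin n → ZMod 2) × E)) (I × ((Fin n → ZMod 2) × E)) ℂ :=
  ((Fintype.card I : ℂ) * (K.card : ℂ))⁻¹ • ∑ i : I, ∑ k ∈ K,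
    ketbra i ⊗ₖ
      ((pauliXZ n (h i k).1 (h i k).2 ⊗ₖ (1 : Matrix E E ℂ)) * ρ *
        (pauliXZ n (h i k).1 (h i k).2 ⊗ₖ (1 : Matrix E E ℂ))ᴴ)

abbrev BV (n : ℕ) := Fin n → ZMod 2

def chi2 (s : ZMod 2) : ℂ := (-1 : ℂ) ^ s.val

lemma chi2_add (s t : ZMod 2) : chi2 (s + t) = chi2 s * chi2 t := by
  unfold chi2
  rw [← pow_add]
  have h : ∀ s t : ZMod 2, (s + t).val % 2 = (s.val + t.val) % 2 := by decide
  rw [← Nat.div_add_mod (s + t).val 2, ← Nat.div_add_mod (s.val + t.val) 2, h]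
  simp [pow_add, pow_mul]

lemma chi2_star (s : ZMod 2) : star (chi2 s) = chi2 s := by
  simp [chi2]

lemma chi2_one : chi2 1 = -1 := by
  simp [chi2, ZMod.val_one]

lemma zmod2_eq_one {s : ZMod 2} (hs : s ≠ 0) : s = 1 := by
  revert s; decide

def bdot {n : ℕ} (v z : BV n) : ZMod 2 := ∑ j, v j * z j

lemma bdot_add_right {n : ℕ} (v z w : BV n) : bdot v (z + w) = bdot v z + bdot v w := by
  simp [bdot, mul_add, Finset.sum_add_distrib]

lemma bdot_add_left {n : ℕ} (v w z : BV n) : bdot (v + w) z = bdot v z + bdot w z := by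
  simp [bdot, add_mul, Finset.sum_add_distrib]

lemma bv_add_self {n : ℕ} (v : BV n) : v + v = 0 := by
  ext j; exact CharTwo.add_self_eq_zero (v j)

lemma bv_add_eq_zero {n : ℕ} {x y : BV n} : x + y = 0 ↔ x = y := by
  constructor
  · intro h
    have : x + y + y = y := by rw [h, zero_add]
    rwa [add_assoc, bv_add_self, add_zero] at this
  · rintro rfl; exact bv_add_self _

lemma sum_chi2 {n : ℕ} (z : BV n) : ∑ v : BV n, chi2 (bdot v z) = if z = 0 then 2 ^ n else 0 := by
  split_ifs with hz
  · subst hz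
    simp [bdot, chi2]
  · obtain ⟨j, hj⟩ := Function.ne_iff.mp hz
    have h1 : z j = 1 := zmod2_eq_one hj
    have h2 : ∑ v : BV n, chi2 (bdot v z) = ∑ v : BV n, chi2 (bdot (v + Pi.single j 1) z) :=
      (Equiv.sum_comp (Equiv.addRight (Pi.single j 1 : BV n)) fun v => chi2 (bdot v z)).symm
    have h3 : bdot (Pi.single j 1 : BV n) z = 1 := by
      simp [bdot, Pi.single_apply, h1]
    have h4 : ∀ v : BV n, chi2 (bdot (v + Pi.single j 1) z) = - chi2 (bdot v z) := by
      intro v; rw [bdot_add_left, chi2_add, h3, chi2_one]; ring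
    simp only [h4, Finset.sum_neg_distrib] at h2
    exact self_eq_neg.mp h2

section XorHelpers

variable {n : ℕ} {E : Type*} [Fintype E] [DecidableEq E]

def conjP (g : BV n × BV n) (M : Matrix (BV n × E) (BV n × E) ℂ) :
    Matrix (BV n × E) (BV n × E) ℂ :=
  Matrix.of fun p q => chi2 (bdot g.2 (p.1 + q.1)) * M (p.1 + g.1, p.2) (q.1 + g.1, q.2)

lemma pauliXZ_apply' (u v x y : BV n) :
    pauliXZ n u v x y = if y = x + u then chi2 (bdot v y) else 0 := by
  have : x = y + u ↔ y = x + u := by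
    constructor <;> (rintro rfl; rw [add_assoc, bv_add_self, add_zero])
  simp only [pauliXZ, Matrix.of_apply, this]
  rfl

lemma conj_pauli (u v : BV n) (M : Matrix (BV n × E) (BV n × E) ℂ) :
    (pauliXZ n u v ⊗ₖ (1 : Matrix E E ℂ)) * M * (pauliXZ n u v ⊗ₖ (1 : Matrix E E ℂ))ᴴ
      = conjP (u, v) M := by
  ext ⟨x, e⟩ ⟨y, f⟩
  simp only [Matrix.mul_apply, Matrix.conjTranspose_apply, Matrix.kroneckerMap_apply,
    pauliXZ_apply', Fintype.sum_prod_type, Matrix.one_apply, conjP, Matrix.of_apply]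
  simp only [ite_mul, mul_ite, mul_one, mul_zero, zero_mul, Finset.sum_ite_eq, Finset.sum_ite_eq', Finset.mem_univ,
    if_true, apply_ite star, star_zero, chi2_star, Finset.sum_ite_irrel, Finset.sum_const_zero]
  have : bdot v (x + y) = bdot v (x + u) + bdot v (y + u) := by
    rw [← bdot_add_right]; congr 1
    rw [add_add_add_comm, bv_add_self, add_zero]
  rw [this, chi2_add]; ring

lemma conjP_conjP (g k : BV n × BV n) (M : Matrix (BV n × E) (BV n × E) ℂ) :
    conjP g (conjP k M) = conjP (k - g) M := by
  have hs : k - g = k + g := by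
    rw [sub_eq_iff_eq_add, add_assoc]
    have : g + g = 0 := Prod.ext (bv_add_self _) (bv_add_self _)
    rw [this, add_zero]
  rw [hs]
  ext ⟨x, e⟩ ⟨y, f⟩
  simp only [conjP, Matrix.of_apply, Prod.fst_add, Prod.snd_add]
  have h1 : x + g.1 + (y + g.1) = x + y := by
    rw [add_add_add_comm, bv_add_self, add_zero]
  rw [h1, bdot_add_left, chi2_add, add_comm k.1 g.1, ← add_assoc, ← add_assoc]; ring

lemma trace_conjP_mul (g : BV n × BV n) (A B : Matrix (BV n × E) (BV n × E) ℂ) :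
    (A * conjP g B).trace = (conjP g A * B).trace := by
  simp only [Matrix.trace, Matrix.diag, Matrix.mul_apply, conjP, Matrix.of_apply]
  have key : ∀ F : BV n × E → BV n × E → ℂ, ∑ p, ∑ q, F p q =
      ∑ p : BV n × E, ∑ q : BV n × E, F (p.1 + g.1, p.2) (q.1 + g.1, q.2) := by
    intro F
    let e : BV n × E ≃ BV n × E := (Equiv.addRight g.1).prodCongr (Equiv.refl E)
    rw [← Equiv.sum_comp e]
    refine Finset.sum_congr rfl fun p _ => ?_
    rw [← Equiv.sum_comp e]
    rfl
  rw [key]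
  refine Finset.sum_congr rfl fun p _ => Finset.sum_congr rfl fun q _ => ?_
  have h1 : q.1 + g.1 + (p.1 + g.1) = p.1 + q.1 := by
    rw [add_add_add_comm, bv_add_self, add_zero, add_comm]
  simp only [h1]
  simp only [add_assoc, bv_add_self, add_zero]
  ring

lemma one_kron_mul_apply (S : Matrix E E ℂ) (M : Matrix (BV n × E) (BV n × E) ℂ) (p q) :
    (((1 : Matrix (BV n) (BV n) ℂ) ⊗ₖ S) * M) p q = ∑ e, S p.2 e * M (p.1, e) q := by
  simp [Matrix.mul_apply, Matrix.kroneckerMap_apply, Fintype.sum_prod_type, Matrix.one_apply,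
    Finset.sum_ite_irrel]

lemma mul_one_kron_apply (S : Matrix E E ℂ) (M : Matrix (BV n × E) (BV n × E) ℂ) (p q) :
    (M * ((1 : Matrix (BV n) (BV n) ℂ) ⊗ₖ S)) p q = ∑ e, M p (q.1, e) * S e q.2 := by
  simp [Matrix.mul_apply, Matrix.kroneckerMap_apply, Fintype.sum_prod_type, Matrix.one_apply,
    Finset.sum_ite_irrel, Finset.sum_comm (γ := E)]

lemma conjP_W (g : BV n × BV n) (S : Matrix E E ℂ) (M : Matrix (BV n × E) (BV n × E) ℂ) :
    ((1 : Matrix (BV n) (BV n) ℂ) ⊗ₖ S) * conjP g M * ((1 : Matrix (BV n) (BV n) ℂ) ⊗ₖ S)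
      = conjP g (((1 : Matrix (BV n) (BV n) ℂ) ⊗ₖ S) * M * ((1 : Matrix (BV n) (BV n) ℂ) ⊗ₖ S)) := by
  ext p q
  simp only [conjP, Matrix.of_apply, one_kron_mul_apply, mul_one_kron_apply, Finset.mul_sum,
    Finset.sum_mul]
  refine Finset.sum_congr rfl fun p _ => Finset.sum_congr rfl fun q _ => ?_
  ring

lemma sum_conjP (M : Matrix (BV n × E) (BV n × E) ℂ) (hM : ptraceA M = 0) :
    ∑ g : BV n × BV n, conjP g M = 0 := by
  ext ⟨x, e⟩ ⟨y, f⟩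
  simp only [Matrix.sum_apply, conjP, Matrix.of_apply, Fintype.sum_prod_type, ← Finset.sum_mul,
    sum_chi2, bv_add_eq_zero, Matrix.zero_apply]
  split_ifs with hxy
  · subst hxy
    rw [← Finset.mul_sum]
    have := congrFun (congrFun hM e) f
    simp only [ptraceA, Matrix.of_apply, Matrix.zero_apply] at this
    rw [← Equiv.sum_comp (Equiv.addLeft x)] at this
    simp only [Equiv.coe_addLeft] at this
    rw [this, mul_zero]
  · simp

open scoped MatrixOrder in
lemma psd_trace_mul {d : Type*} [Fintype d] [DecidableEq d] {A B : Matrix d d ℂ}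
    (hA : A.PosSemidef) (hB : B.PosSemidef) : 0 ≤ (A * B).trace.re := by
  obtain ⟨C, rfl⟩ := CStarAlgebra.nonneg_iff_eq_star_mul_self.mp hB.nonneg
  rw [Matrix.star_eq_conjTranspose, ← Matrix.mul_assoc, Matrix.trace_mul_comm, ← Matrix.mul_assoc]
  have := (hA.mul_mul_conjTranspose_same C).trace_nonneg
  exact (Complex.nonneg_iff.mp this).1

lemma ptraceA_psd_s17 {M : Matrix (BV n × E) (BV n × E) ℂ} (hM : M.PosSemidef) :
    (ptraceA M).PosSemidef := by
  have : ptraceA M = ∑ a : BV n, M.submatrix (fun e => (a, e)) (fun e => (a, e)) := by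
    ext e f; simp [ptraceA, Matrix.sum_apply]
  rw [this]
  exact Matrix.posSemidef_sum _ fun a _ => hM.submatrix _

lemma sqrt_herm {A : Matrix E E ℂ} (hA : A.PosSemidef) : hA.sqrt.IsHermitian := by
  unfold Matrix.PosSemidef.sqrt
  have hd : (diagonal ((RCLike.ofReal : ℝ → ℂ) ∘ Real.sqrt ∘ hA.1.eigenvalues) : Matrix E E ℂ).IsHermitian := by
    apply Matrix.isHermitian_diagonal_of_self_adjoint
    ext i; simp
  exact Matrix.isHermitian_mul_mul_conjTranspose _ hd

lemma sqrt_mul_self {A : Matrix E E ℂ} (hA : A.PosSemidef) : hA.sqrt * hA.sqrt = A := by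
  conv_rhs => rw [hA.1.spectral_theorem]
  unfold Matrix.PosSemidef.sqrt
  rw [Unitary.conjStarAlgAut_apply]
  have hu : (star (hA.1.eigenvectorUnitary : Matrix E E ℂ)) * hA.1.eigenvectorUnitary.1 = 1 :=
    Unitary.coe_star_mul_self _
  have hd : (diagonal ((RCLike.ofReal : ℝ → ℂ) ∘ Real.sqrt ∘ hA.1.eigenvalues) : Matrix E E ℂ) *
     (diagonal ((RCLike.ofReal : ℝ → ℂ) ∘ Real.sqrt ∘ hA.1.eigenvalues) : Matrix E E ℂ) =
     diagonal (RCLike.ofReal ∘ hA.1.eigenvalues) := by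
    rw [Matrix.diagonal_mul_diagonal]
    congr 1; ext i
    change ((√(hA.1.eigenvalues i) : ℝ) : ℂ) * ((√(hA.1.eigenvalues i) : ℝ) : ℂ) = ((hA.1.eigenvalues i : ℝ) : ℂ)
    rw [← Complex.ofReal_mul, Real.mul_self_sqrt (hA.eigenvalues_nonneg i)]
  rw [← hd]
  generalize (diagonal ((RCLike.ofReal : ℝ → ℂ) ∘ Real.sqrt ∘ hA.1.eigenvalues) : Matrix E E ℂ) = D at *
  simp only [Matrix.mul_assoc]
  rw [← Matrix.mul_assoc (star _) _ (D * _), hu, Matrix.one_mul]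

/-- The main estimate for the state before encryption. -/
lemma main_est {c : ℝ} {ρ : Matrix (BV n × E) (BV n × E) ℂ} (hρ : ρ.PosSemidef)
    (htr : ρ.trace = 1) {σ S : Matrix E E ℂ} (hS : S.IsHermitian) (hSσ : S * σ * S = 1)
    (hmin : ((c : ℂ) • ((1 : Matrix (BV n) (BV n) ℂ) ⊗ₖ σ) - ρ).PosSemidef)
    {τ : Matrix (BV n × E) (BV n × E) ℂ}
    (hτ : τ = ρ - ((2 : ℂ) ^ n)⁻¹ • ((1 : Matrix (BV n) (BV n) ℂ) ⊗ₖ ptraceA ρ))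
    (hτ0 : ptraceA τ = 0) :
    (τ * (((1 : Matrix (BV n) (BV n) ℂ) ⊗ₖ S) * τ * ((1 : Matrix (BV n) (BV n) ℂ) ⊗ₖ S))).trace.re
      ≤ c := by
  set W := (1 : Matrix (BV n) (BV n) ℂ) ⊗ₖ S with hW
  have hWh : Wᴴ = W := by
    rw [hW, Matrix.conjTranspose_kronecker, Matrix.conjTranspose_one, hS.eq]
  have hzero : ∀ R : Matrix E E ℂ, (((1 : Matrix (BV n) (BV n) ℂ) ⊗ₖ R) * (W * τ * W)).trace = 0 := by
    intro R
    have h1 : (((1 : Matrix (BV n) (BV n) ℂ) ⊗ₖ R) * (W * τ * W)).trace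
        = (((1 : Matrix (BV n) (BV n) ℂ) ⊗ₖ (S * R * S)) * τ).trace := by
      rw [← Matrix.mul_assoc, Matrix.trace_mul_comm]
      simp only [← Matrix.mul_assoc]
      rw [hW]
      simp only [← Matrix.mul_kronecker_mul, Matrix.mul_one]
    rw [h1]
    simp only [Matrix.trace, Matrix.diag, one_kron_mul_apply, Fintype.sum_prod_type]
    rw [Finset.sum_comm]
    refine Finset.sum_eq_zero fun e _ => ?_
    rw [Finset.sum_comm]
    refine Finset.sum_eq_zero fun f _ => ?_
    rw [← Finset.mul_sum]
    have := congrFun (congrFun hτ0 f) e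
    simp only [ptraceA, Matrix.of_apply, Matrix.zero_apply] at this
    rw [this, mul_zero]
  have e1 : (τ * (W * τ * W)).trace = (ρ * (W * τ * W)).trace := by
    conv_lhs => rw [hτ, Matrix.sub_mul, ← hτ]
    rw [Matrix.trace_sub, Matrix.smul_mul, Matrix.trace_smul, hzero, smul_zero, sub_zero]
  have hB : (W * ((1 : Matrix (BV n) (BV n) ℂ) ⊗ₖ ptraceA ρ) * W).PosSemidef := by
    have := (Matrix.PosSemidef.one.kronecker (ptraceA_psd_s17 hρ) :
      ((1 : Matrix (BV n) (BV n) ℂ) ⊗ₖ ptraceA ρ).PosSemidef).mul_mul_conjTranspose_same W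
    rwa [hWh] at this
  have e2 : (ρ * (W * τ * W)).trace.re ≤ (ρ * (W * ρ * W)).trace.re := by
    rw [hτ, Matrix.mul_sub, Matrix.sub_mul, Matrix.mul_sub, Matrix.trace_sub, Complex.sub_re]
    rw [Matrix.mul_smul, Matrix.smul_mul, Matrix.mul_smul, Matrix.trace_smul]
    have h1 := psd_trace_mul hρ hB
    have h2 : (((2 : ℂ) ^ n)⁻¹) = (((2 : ℝ) ^ n)⁻¹ : ℝ) := by push_cast; rfl
    rw [h2, smul_eq_mul, Complex.re_ofReal_mul]
    have : 0 ≤ ((2 : ℝ) ^ n)⁻¹ := by positivity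
    nlinarith [mul_nonneg this h1]
  have hC : (W * ρ * W).PosSemidef := by
    have := hρ.mul_mul_conjTranspose_same W
    rwa [hWh] at this
  have e3 := psd_trace_mul hmin hC
  rw [Matrix.sub_mul, Matrix.trace_sub, Complex.sub_re, Matrix.smul_mul, Matrix.trace_smul,
    smul_eq_mul, Complex.re_ofReal_mul] at e3
  have e4 : (((1 : Matrix (BV n) (BV n) ℂ) ⊗ₖ σ) * (W * ρ * W)).trace = 1 := by
    rw [← Matrix.mul_assoc, Matrix.trace_mul_comm]
    simp only [← Matrix.mul_assoc]
    rw [hW]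
    simp only [← Matrix.mul_kronecker_mul, Matrix.mul_one, hSσ, Matrix.one_kronecker_one,
      Matrix.one_mul, htr]
  rw [e4] at e3
  rw [e1]
  simp at e3
  linarith

lemma ptrace_tilde (ρ : Matrix (BV n × E) (BV n × E) ℂ) :
    ptraceA (ρ - ((2 : ℂ) ^ n)⁻¹ • ((1 : Matrix (BV n) (BV n) ℂ) ⊗ₖ ptraceA ρ)) = 0 := by
  ext e f
  simp [ptraceA, Matrix.kroneckerMap_apply]

lemma ketbra_trace {I : Type*} [Fintype I] [DecidableEq I] (i j : I) :
    (ketbra i * ketbra j).trace = if i = j then 1 else 0 := by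
  have h : ∀ i : I, ketbra i = Matrix.single i i (1 : ℂ) := by
    intro i; ext a b; simp [ketbra, Matrix.single_apply, eq_comm]
  rw [h, h]
  split_ifs with hij
  · subst hij; simp
  · rw [Matrix.single_mul_single_of_ne (h := hij)]; simp

lemma trace_cross (S : Matrix E E ℂ) (τ : Matrix (BV n × E) (BV n × E) ℂ) (g k : BV n × BV n) :
    (conjP g τ * ((1 : Matrix (BV n) (BV n) ℂ) ⊗ₖ S) * conjP k τ *
      ((1 : Matrix (BV n) (BV n) ℂ) ⊗ₖ S)).trace
    = (conjP (g - k) τ * (((1 : Matrix (BV n) (BV n) ℂ) ⊗ₖ S) * τ *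
      ((1 : Matrix (BV n) (BV n) ℂ) ⊗ₖ S))).trace := by
  rw [Matrix.mul_assoc, Matrix.mul_assoc, ← Matrix.mul_assoc _ (conjP k τ), conjP_W,
    trace_conjP_mul, conjP_conjP]

lemma conjP_zero (τ : Matrix (BV n × E) (BV n × E) ℂ) : conjP 0 τ = τ := by
  ext p q
  simp [conjP, bdot, chi2]

lemma cipher_trace {I : Type*} [Fintype I] [DecidableEq I] [Nonempty I]
    (h : I → (Fin (2 * n) → ZMod 2) → (Fin n → ZMod 2) × (Fin n → ZMod 2))
    (hXOR : StronglyXORUniversal h)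
    (K : Finset (Fin (2 * n) → ZMod 2)) (hK : K.Nonempty)
    (S : Matrix E E ℂ) (τ : Matrix (BV n × E) (BV n × E) ℂ) (hτ : ptraceA τ = 0) :
    (XORCipher h K τ * ((1 : Matrix I I ℂ) ⊗ₖ ((1 : Matrix (BV n) (BV n) ℂ) ⊗ₖ S)) *
      XORCipher h K τ * ((1 : Matrix I I ℂ) ⊗ₖ ((1 : Matrix (BV n) (BV n) ℂ) ⊗ₖ S))).trace
    = ((Fintype.card I : ℂ) * (K.card : ℂ))⁻¹ *
      (τ * (((1 : Matrix (BV n) (BV n) ℂ) ⊗ₖ S) * τ * ((1 : Matrix (BV n) (BV n) ℂ) ⊗ₖ S))).trace := by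
  set W := (1 : Matrix (BV n) (BV n) ℂ) ⊗ₖ S with hW
  set c := ((Fintype.card I : ℂ) * (K.card : ℂ))⁻¹ with hc
  set T := W * τ * W with hT
  have hcross : ∀ k l, ∑ i : I, (conjP (h i k) τ * W * conjP (h i l) τ * W).trace
      = if k = l then (Fintype.card I : ℂ) * (τ * T).trace else 0 := by
    intro k l
    simp only [hW, trace_cross]
    simp only [← hW, ← hT]
    split_ifs with hkl
    · subst hkl
      simp [conjP_zero]
    · have hfib : ∑ i : I, (conjP (h i k - h i l) τ * T).trace =
          ∑ a : BV n × BV n, ∑ i ∈ Finset.univ.filter (fun i => h i k - h i l = a),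
            (conjP (h i k - h i l) τ * T).trace :=
        (Finset.sum_fiberwise _ _ _).symm
      rw [hfib]
      have h2 : ∀ a : BV n × BV n, ∑ i ∈ Finset.univ.filter (fun i => h i k - h i l = a),
            (conjP (h i k - h i l) τ * T).trace
          = ((Fintype.card I : ℂ) / 2 ^ (2 * n)) * (conjP a τ * T).trace := by
        intro a
        have h3 : ∑ i ∈ Finset.univ.filter (fun i => h i k - h i l = a),
            (conjP (h i k - h i l) τ * T).trace =
            ∑ i ∈ Finset.univ.filter (fun i => h i k - h i l = a), (conjP a τ * T).trace :=
          Finset.sum_congr rfl fun i hi => by rw [(Finset.mem_filter.mp hi).2]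
        rw [h3, Finset.sum_const, nsmul_eq_mul, ← hXOR a k l hkl]
        push_cast
        rw [mul_div_cancel_right₀ _ (by positivity)]
      simp only [h2]
      rw [← Finset.mul_sum, ← Matrix.trace_sum, ← Finset.sum_mul, sum_conjP τ hτ]
      simp
  have hE : XORCipher h K τ = c • ∑ i : I, ketbra i ⊗ₖ (∑ k ∈ K, conjP (h i k) τ) := by
    unfold XORCipher
    rw [← hc]
    congr 1
    refine Finset.sum_congr rfl fun i _ => ?_
    simp only [conj_pauli]
    ext p q
    simp [Matrix.sum_apply, Matrix.kroneckerMap_apply, Finset.mul_sum]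
  rw [hE]
  have hblk : ∀ M : I → Matrix (BV n × E) (BV n × E) ℂ,
      ((c • ∑ i : I, ketbra i ⊗ₖ M i) * ((1 : Matrix I I ℂ) ⊗ₖ W) *
        (c • ∑ i : I, ketbra i ⊗ₖ M i) * ((1 : Matrix I I ℂ) ⊗ₖ W)).trace =
      c • c • ∑ i : I, (M i * W * M i * W).trace := by
    intro M
    simp only [Matrix.smul_mul, Matrix.mul_smul, Matrix.trace_smul, Finset.sum_mul,
      Finset.mul_sum, ← Matrix.mul_kronecker_mul, Matrix.mul_one, Matrix.trace_sum,
      Matrix.trace_kronecker, ketbra_trace, ite_mul, one_mul, zero_mul, Finset.sum_ite_eq,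
      Finset.sum_ite_eq', Finset.mem_univ, if_true]
    rw [← Finset.smul_sum]
  rw [hblk]
  have : ∑ i : I, ∑ k ∈ K, ∑ l ∈ K, (conjP (h i k) τ * W * conjP (h i l) τ * W).trace
      = (K.card : ℂ) * ((Fintype.card I : ℂ) * (τ * T).trace) := by
    rw [Finset.sum_comm]
    have : ∀ k ∈ K, ∑ i : I, ∑ l ∈ K, (conjP (h i k) τ * W * conjP (h i l) τ * W).trace
      = (Fintype.card I : ℂ) * (τ * T).trace := by
      intro k hk
      rw [Finset.sum_comm]
      simp only [hcross]
      simp [hk]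
    rw [Finset.sum_congr rfl this]
    simp
  have hc' : c * ((Fintype.card I : ℂ) * (K.card : ℂ)) = 1 := by
    rw [hc]
    apply inv_mul_cancel₀
    have := hK.card_ne_zero
    have := Fintype.card_ne_zero (α := I)
    simp_all
  have hfin : c • c • (∑ i : I, ∑ k ∈ K, ∑ l ∈ K, (conjP (h i k) τ * W * conjP (h i l) τ * W).trace)
     = c * (τ * T).trace := by
    rw [this, smul_eq_mul, smul_eq_mul]
    linear_combination c * (τ * T).trace * hc'
  rw [← hfin]
  congr 2
  refine Finset.sum_congr rfl fun i _ => ?_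
  simp only [Finset.sum_mul, Finset.mul_sum, Matrix.trace_sum]
  rw [Finset.sum_comm]

end XorHelpers

/-- for the XOR-universal cipher, a density matrix `ρ` and a
positive definite density `σ` with `ρ ≤ 2^{-t}(I ⊗ σ)`, setting
`ρ̃ = ρ - (I/2^n) ⊗ tr_A ρ`, one has
`tr[E(ρ̃)(I ⊗ σ^{-1/2})E(ρ̃)(I ⊗ σ^{-1/2})] ≤ 2^{-t}/(|I||K|)`. -/
theorem xor_cipher_two_norm_bound {n dE : ℕ} (hn : 1 ≤ n)
    {I : Type*} [Fintype I] [DecidableEq I] [Nonempty I]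
    (h : I → (Fin (2 * n) → ZMod 2) → (Fin n → ZMod 2) × (Fin n → ZMod 2))
    (hXOR : StronglyXORUniversal h)
    (K : Finset (Fin (2 * n) → ZMod 2)) (hK : K.Nonempty)
    (t : ℝ)
    (ρ : Matrix ((Fin n → ZMod 2) × Fin dE) ((Fin n → ZMod 2) × Fin dE) ℂ)
    (hρ : IsDensity ρ)
    (σ : Matrix (Fin dE) (Fin dE) ℂ) (hσpd : σ.PosDef) (hσtr : σ.trace = 1)
    (hmin : LoewnerLE ρ ((((2 : ℝ) ^ (-t) : ℝ) : ℂ) •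
      ((1 : Matrix (Fin n → ZMod 2) (Fin n → ZMod 2) ℂ) ⊗ₖ σ))) :
    (Matrix.trace
        (XORCipher h K (ρ - ((2 : ℂ) ^ n)⁻¹ •
            ((1 : Matrix (Fin n → ZMod 2) (Fin n → ZMod 2) ℂ) ⊗ₖ ptraceA ρ)) *
          ((1 : Matrix I I ℂ) ⊗ₖ
            ((1 : Matrix (Fin n → ZMod 2) (Fin n → ZMod 2) ℂ) ⊗ₖ (hσpd.posSemidef.sqrt)⁻¹)) *
          XORCipher h K (ρ - ((2 : ℂ) ^ n)⁻¹ •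
            ((1 : Matrix (Fin n → ZMod 2) (Fin n → ZMod 2) ℂ) ⊗ₖ ptraceA ρ)) *
          ((1 : Matrix I I ℂ) ⊗ₖ
            ((1 : Matrix (Fin n → ZMod 2) (Fin n → ZMod 2) ℂ) ⊗ₖ (hσpd.posSemidef.sqrt)⁻¹)))).re
      ≤ (2 : ℝ) ^ (-t) / ((Fintype.card I : ℝ) * (K.card : ℝ)) := by
  obtain ⟨hρp, hρt⟩ := hρ
  set s := hσpd.posSemidef.sqrt with hs
  have hss : s * s = σ := sqrt_mul_self _
  have hsh : s.IsHermitian := sqrt_herm _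
  have hu : IsUnit s.det := by
    have h1 : IsUnit σ.det := (Matrix.isUnit_iff_isUnit_det _).mp hσpd.isUnit
    rw [← hss, Matrix.det_mul] at h1
    exact isUnit_of_mul_isUnit_left h1
  have hSσ : s⁻¹ * σ * s⁻¹ = 1 := by
    rw [← hss, ← Matrix.mul_assoc, Matrix.nonsing_inv_mul _ hu, Matrix.one_mul,
      Matrix.mul_nonsing_inv _ hu]
  have key := cipher_trace h hXOR K hK s⁻¹ _ (ptrace_tilde ρ)
  have est := main_est hρp hρt hsh.inv hSσ hmin rfl (ptrace_tilde ρ)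
  refine (congrArg Complex.re key).trans_le ?_
  have h2 : ((Fintype.card I : ℂ) * (K.card : ℂ))⁻¹
      = (((Fintype.card I : ℝ) * (K.card : ℝ))⁻¹ : ℝ) := by push_cast; rfl
  rw [h2, Complex.re_ofReal_mul, div_eq_inv_mul]
  exact mul_le_mul_of_nonneg_left est (by positivity)
end
end
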